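/- arXiv:2309.00130 — 3 statements merged into one kernel-verified Lean document; each statement's English description precedes it below -/
import Mathlib

section
/- Let p ≥ 4 and N be integers with 1 ≤ N ≤ p. Then for every θ ∈ ℝ, Σ_{j=0}^{p−1} |(1 − e^{−2πiN(j+θ)/p}) / (1 − e^{−2πi(j+θ)/p})| ≤ 2p·log p, where at points where the denominator vanishes (i.e. (j+θ)/p ∈ ℤ) the ratio is interpreted by continuity as N. -/
open scoped Real

noncomputable section

/-- The Dirichlet-kernel type function `x ↦ |(1 - e^{-2πiNx})/(1 - e^{-2πix})|`, with the
removable singularities at integer `x` interpreted by continuity (value `N`): it equals the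
absolute value of the geometric sum `Σ_{r=0}^{N-1} e^{-2πirx}` of `N` unimodular terms. -/
def dker (N : ℕ) (x : ℝ) : ℝ :=
  ‖∑ r ∈ Finset.range N,
      Complex.exp ((((-(2 * Real.pi * r * x)) : ℝ) : ℂ) * Complex.I)‖

lemma dker_nonneg (N : ℕ) (x : ℝ) : 0 ≤ dker N x := norm_nonneg _

lemma dker_le (N : ℕ) (x : ℝ) : dker N x ≤ N := by
  unfold dker
  refine (norm_sum_le _ _).trans ?_
  simp only [Complex.norm_exp_ofReal_mul_I]
  simp

lemma dker_add_one (N : ℕ) (x : ℝ) : dker N (x + 1) = dker N x := by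
  unfold dker
  congr 1
  refine Finset.sum_congr rfl fun r _ => ?_
  rw [Complex.exp_eq_exp_iff_exists_int]
  refine ⟨-(r : ℤ), ?_⟩
  push_cast
  ring

lemma dker_geom (N : ℕ) (x : ℝ) : dker N x * (2 * |Real.sin (π * x)|) ≤ 2 := by
  set z : ℂ := Complex.exp (Complex.I * ((-(2 * π * x) : ℝ) : ℂ)) with hz
  have h1 : dker N x = ‖∑ r ∈ Finset.range N, z ^ r‖ := by
    unfold dker
    congr 1
    refine Finset.sum_congr rfl fun r _ => ?_
    rw [hz, ← Complex.exp_nat_mul]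
    congr 1
    push_cast
    ring
  have h2 : ‖z - 1‖ = 2 * |Real.sin (π * x)| := by
    rw [hz, Complex.norm_exp_I_mul_ofReal_sub_one]
    have : -(2 * π * x) / 2 = -(π * x) := by ring
    rw [this, Real.sin_neg, Real.norm_eq_abs, abs_mul, abs_neg, abs_two]
  have hn : ‖z‖ = 1 := by
    rw [hz, mul_comm, Complex.norm_exp_ofReal_mul_I]
  rw [h1, ← h2, ← norm_mul, geom_sum_mul]
  refine (norm_sub_le _ _).trans ?_
  rw [norm_pow, hn]
  norm_num

lemma two_min_le_sin (x : ℝ) (h0 : 0 ≤ x) (h1 : x ≤ 1) : 2 * min x (1 - x) ≤ Real.sin (π * x) := by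
  have hpi := Real.pi_pos
  rcases le_total x (1 / 2) with h | h
  · have := Real.mul_le_sin (x := π * x) (by positivity) (by nlinarith)
    have e : 2 / π * (π * x) = 2 * x := by field_simp
    rw [e] at this
    have := min_le_left x (1 - x)
    linarith
  · have := Real.mul_le_sin (x := π * (1 - x)) (mul_nonneg hpi.le (by linarith)) (by nlinarith)
    have e : 2 / π * (π * (1 - x)) = 2 * (1 - x) := by field_simp
    have e2 : π * (1 - x) = π - π * x := by ring
    rw [e, e2, Real.sin_pi_sub] at this
    have := min_le_right x (1 - x)
    linarith

lemma dker_bound (N : ℕ) (x : ℝ) (h0 : 0 < x) (h1 : x < 1) :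
    dker N x ≤ (1 / x + 1 / (1 - x)) / 2 := by
  have h2 := two_min_le_sin x h0.le h1.le
  have h3 := dker_geom N x
  have h1' : 0 < 1 - x := by linarith
  have hm : 0 < min x (1 - x) := lt_min h0 h1'
  rw [abs_of_nonneg (by linarith)] at h3
  have h4 : dker N x * (2 * min x (1 - x)) ≤ 1 := by
    have := mul_le_mul_of_nonneg_left h2 (dker_nonneg N x)
    linarith
  have h5 : dker N x ≤ 1 / (min x (1 - x)) / 2 := by
    rw [div_div, le_div_iff₀ (by positivity)]
    linarith
  refine h5.trans ?_
  have a : 0 < 1 / x := by positivity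
  have b : 0 < 1 / (1 - x) := by positivity
  rcases min_choice x (1 - x) with h | h <;> rw [h] <;> linarith

lemma dsum_periodic (p N : ℕ) (hp : 4 ≤ p) :
    Function.Periodic (fun θ : ℝ => ∑ j ∈ Finset.range p, dker N (((j : ℝ) + θ) / p)) 1 := by
  intro θ
  have hp0 : (p : ℝ) ≠ 0 := by positivity
  have h1 := Finset.sum_range_succ (fun j : ℕ => dker N (((j : ℝ) + θ) / p)) p
  have h2 := Finset.sum_range_succ' (fun j : ℕ => dker N (((j : ℝ) + θ) / p)) p
  have h3 : dker N (((p : ℝ) + θ) / p) = dker N (((0 : ℕ) + θ) / p) := by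
    rw [← dker_add_one N (((0 : ℕ) + θ) / p)]
    congr 1
    field_simp
    push_cast
    ring
  have h4 : ∑ j ∈ Finset.range p, dker N (((j : ℝ) + (θ + 1)) / p)
      = ∑ j ∈ Finset.range p, dker N ((((j + 1 : ℕ) : ℝ) + θ) / p) := by
    refine Finset.sum_congr rfl fun j _ => ?_
    congr 2
    push_cast
    ring
  show ∑ j ∈ Finset.range p, dker N (((j : ℝ) + (θ + 1)) / p) = _
  rw [h4]
  simp only at h1 h2 ⊢
  linarith

lemma dsum_large (p N : ℕ) (hp : 30 ≤ p) (hNp : N ≤ p) (θ : ℝ) (h0 : 0 ≤ θ) (h1 : θ < 1) :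
    ∑ j ∈ Finset.range p, dker N (((j : ℝ) + θ) / p) ≤ 2 * p * Real.log p := by
  obtain ⟨m, rfl⟩ : ∃ m, p = m + 2 := ⟨p - 2, by omega⟩
  have hNp' : (N : ℝ) ≤ ((m + 2 : ℕ) : ℝ) := by exact_mod_cast hNp
  rw [Finset.sum_range_succ, Finset.sum_range_succ']
  have b1 := (dker_le N ((((0 : ℕ) : ℝ) + θ) / ((m + 2 : ℕ) : ℝ))).trans hNp'
  have b2 := (dker_le N ((((m + 1 : ℕ) : ℝ) + θ) / ((m + 2 : ℕ) : ℝ))).trans hNp'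
  set P : ℝ := ((m + 2 : ℕ) : ℝ) with hP
  have hPm : P = m + 2 := by rw [hP]; push_cast; ring
  have hPpos : 0 < P := by rw [hPm]; positivity
  have b3 : ∑ k ∈ Finset.range m, dker N ((((k + 1 : ℕ) : ℝ) + θ) / P) ≤
      ∑ k ∈ Finset.range m, P / 2 * (1 / ((k : ℝ) + 1) + 1 / (((m - 1 - k : ℕ) : ℝ) + 1)) := by
    refine Finset.sum_le_sum fun k hk => ?_
    have hk' : k + 1 ≤ m := Finset.mem_range.1 hk
    have hkR : (k : ℝ) + 1 ≤ m := by exact_mod_cast hk'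
    have e : ((m - 1 - k : ℕ) : ℝ) = m - 1 - k := by
      rw [Nat.cast_sub (by omega), Nat.cast_sub (by omega)]; simp
    have hk0 : (0 : ℝ) ≤ k := by positivity
    rw [e]
    push_cast
    have hy : 0 < (k : ℝ) + 1 + θ := by linarith
    have hy2 : 0 < P - ((k : ℝ) + 1 + θ) := by linarith
    refine (dker_bound N _ (by positivity) (by rw [div_lt_one hPpos]; linarith)).trans ?_
    have e1 : 1 / (((k : ℝ) + 1 + θ) / P) = P * (1 / ((k : ℝ) + 1 + θ)) := by field_simp
    have e2 : 1 / (1 - ((k : ℝ) + 1 + θ) / P) = P * (1 / (P - ((k : ℝ) + 1 + θ))) := by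
      rw [one_sub_div hPpos.ne', one_div_div]; ring
    rw [e1, e2]
    have c1 : 1 / ((k : ℝ) + 1 + θ) ≤ 1 / ((k : ℝ) + 1) :=
      one_div_le_one_div_of_le (by linarith) (by linarith)
    have c2 : 1 / (P - ((k : ℝ) + 1 + θ)) ≤ 1 / ((m : ℝ) - 1 - k + 1) :=
      one_div_le_one_div_of_le (by linarith) (by linarith)
    have := mul_le_mul_of_nonneg_left (add_le_add c1 c2) hPpos.le
    linarith
  have hH : ∑ k ∈ Finset.range m, 1 / ((k : ℝ) + 1) ≤ 1 + Real.log m := by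
    have := harmonic_le_one_add_log m
    simpa [harmonic] using this
  rw [← Finset.mul_sum, Finset.sum_add_distrib,
    Finset.sum_range_reflect (fun k : ℕ => 1 / ((k : ℝ) + 1)) m] at b3
  have hm30 : (30 : ℝ) ≤ P := by rw [hP]; exact_mod_cast hp
  have hlm : Real.log m ≤ Real.log P := Real.log_le_log (by linarith) (by linarith)
  have hl3 : 3 ≤ Real.log P := by
    rw [Real.le_log_iff_exp_le hPpos]
    have e3 : Real.exp 3 = Real.exp 1 ^ 3 := by rw [← Real.exp_nat_mul]; norm_num
    have := pow_le_pow_left₀ (Real.exp_pos 1).le Real.exp_one_lt_d9.le 3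
    rw [e3]
    refine this.trans (le_trans ?_ hm30)
    norm_num
  have : P / 2 * (∑ k ∈ Finset.range m, 1 / ((k : ℝ) + 1) + ∑ k ∈ Finset.range m, 1 / ((k : ℝ) + 1))
      ≤ P * (1 + Real.log P) := by nlinarith
  nlinarith

lemma dk_inner_sum (p r s : ℕ) (hr : r < p) (hs : s < p) (θ : ℝ) :
    ∑ j ∈ Finset.range p, Complex.exp (2 * π * Complex.I * ((s : ℂ) - r) * (((j : ℂ) + θ) / p))
      = if r = s then (p : ℂ) else 0 := by
  have hp0 : (p : ℂ) ≠ 0 := by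
    have : p ≠ 0 := by omega
    exact_mod_cast this
  split_ifs with h
  · subst h; simp
  · set w : ℂ := Complex.exp (2 * π * Complex.I * (((s : ℂ) - r) / p)) with hw
    have e : ∀ j ∈ Finset.range p,
        Complex.exp (2 * π * Complex.I * ((s : ℂ) - r) * (((j : ℂ) + θ) / p))
        = Complex.exp (2 * π * Complex.I * ((s : ℂ) - r) * (θ / p)) * w ^ j := by
      intro j _
      rw [hw, ← Complex.exp_nat_mul, ← Complex.exp_add]
      congr 1
      ring
    rw [Finset.sum_congr rfl e, ← Finset.mul_sum]
    have hw1 : w ≠ 1 := by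
      intro h1
      rw [hw, Complex.exp_eq_one_iff] at h1
      obtain ⟨n, hn⟩ := h1
      have hpi : (2 * π * Complex.I : ℂ) ≠ 0 := Complex.two_pi_I_ne_zero
      rw [mul_comm (n : ℂ)] at hn
      have h2 := mul_left_cancel₀ hpi hn
      rw [div_eq_iff hp0] at h2
      have h3 : (s : ℤ) - r = n * p := by exact_mod_cast h2
      have hn0 : n ≠ 0 := by
        rintro rfl
        apply h
        omega
      rcases lt_or_gt_of_ne hn0 with h4 | h4
      · nlinarith
      · nlinarith
    have hwp : w ^ p = 1 := by
      rw [hw, ← Complex.exp_nat_mul, Complex.exp_eq_one_iff]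
      refine ⟨(s : ℤ) - r, ?_⟩
      push_cast
      field_simp
    rw [geom_sum_eq hw1, hwp]
    simp

lemma dk_sum_sq (p N : ℕ) (hNp : N ≤ p) (θ : ℝ) :
    ∑ j ∈ Finset.range p, dker N (((j : ℝ) + θ) / p) ^ 2 = p * N := by
  have key : ∀ x : ℝ, ((dker N x ^ 2 : ℝ) : ℂ) = ∑ r ∈ Finset.range N, ∑ s ∈ Finset.range N,
      Complex.exp (2 * π * Complex.I * ((s : ℂ) - r) * x) := by
    intro x
    unfold dker
    rw [Complex.ofReal_pow, ← Complex.mul_conj', map_sum, Finset.sum_mul_sum]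
    refine Finset.sum_congr rfl fun r _ => Finset.sum_congr rfl fun s _ => ?_
    rw [← Complex.exp_conj, ← Complex.exp_add, map_mul, Complex.conj_ofReal, Complex.conj_I]
    congr 1
    push_cast
    ring
  have : ((∑ j ∈ Finset.range p, dker N (((j : ℝ) + θ) / p) ^ 2 : ℝ) : ℂ) = p * N := by
    rw [Complex.ofReal_sum, Finset.sum_congr rfl fun j _ => key _, Finset.sum_comm]
    have : ∀ r ∈ Finset.range N, ∑ j ∈ Finset.range p, ∑ s ∈ Finset.range N,
        Complex.exp (2 * π * Complex.I * ((s : ℂ) - r) * ((((j : ℝ) + θ) / p : ℝ) : ℂ)) = p := by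
      intro r hr
      rw [Finset.sum_comm]
      have hr' := Finset.mem_range.1 hr
      have : ∀ s ∈ Finset.range N, ∑ j ∈ Finset.range p,
        Complex.exp (2 * π * Complex.I * ((s : ℂ) - r) * ((((j : ℝ) + θ) / p : ℝ) : ℂ))
          = if r = s then (p : ℂ) else 0 := by
        intro s hs
        have hs' := Finset.mem_range.1 hs
        rw [← dk_inner_sum p r s (by omega) (by omega) θ]
        push_cast
        rfl
      rw [Finset.sum_congr rfl this, Finset.sum_ite_eq, if_pos hr]
    rw [Finset.sum_congr rfl this]
    simp [mul_comm]
  exact_mod_cast this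

lemma dsum_small (p N : ℕ) (hp : 4 ≤ p) (hp2 : p ≤ 30) (hNp : N ≤ p) (θ : ℝ) :
    ∑ j ∈ Finset.range p, dker N (((j : ℝ) + θ) / p) ≤ 2 * p * Real.log p := by
  have hcs := sq_sum_le_card_mul_sum_sq (s := Finset.range p)
    (f := fun j : ℕ => dker N (((j : ℝ) + θ) / p))
  rw [dk_sum_sq p N hNp, Finset.card_range] at hcs
  have hN : (N : ℝ) ≤ p := by exact_mod_cast hNp
  have hpos : (0 : ℝ) < p := by positivity
  have hl2 := Real.log_two_gt_d9
  have main : ∀ k : ℕ, 2 ^ k ≤ p → (k : ℝ) * Real.log 2 ≤ Real.log p := by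
    intro k hk
    rw [← Real.log_pow]
    exact Real.log_le_log (by positivity) (by exact_mod_cast hk)
  have hlog : (p : ℝ) ≤ (2 * Real.log p) ^ 2 ∧ 0 ≤ Real.log p := by
    rcases lt_or_ge p 8 with h | h
    · have := main 2 (by omega)
      have h7 : (p : ℝ) ≤ 7 := by exact_mod_cast (by omega : p ≤ 7)
      push_cast at this
      constructor <;> nlinarith
    rcases lt_or_ge p 16 with h' | h'
    · have := main 3 (by omega)
      have h7 : (p : ℝ) ≤ 15 := by exact_mod_cast (by omega : p ≤ 15)
      push_cast at this
      constructor <;> nlinarith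
    · have := main 4 (by omega)
      have h7 : (p : ℝ) ≤ 30 := by exact_mod_cast hp2
      push_cast at this
      constructor <;> nlinarith
  obtain ⟨hl, hl0⟩ := hlog
  refine (abs_le_of_sq_le_sq' (hcs.trans ?_) (by positivity)).2
  have a1 : (p : ℝ) * (p * N) ≤ p * (p * (2 * Real.log p) ^ 2) := by
    gcongr
    exact hN.trans hl
  refine a1.trans (le_of_eq ?_)
  ring

theorem statement7 (p N : ℕ) (hp : 4 ≤ p) (hN1 : 1 ≤ N) (hNp : N ≤ p) (θ : ℝ) :
    ∑ j ∈ Finset.range p, dker N (((j : ℝ) + θ) / p) ≤ 2 * p * Real.log p := by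
  rcases le_total p 30 with h | h
  · exact dsum_small p N hp h hNp θ
  · have hper := (dsum_periodic p N hp).sub_zsmul_eq (x := θ) ⌊θ⌋
    have e : θ - ⌊θ⌋ • (1 : ℝ) = Int.fract θ := by simp
    rw [e] at hper
    rw [← hper]
    exact dsum_large p N h hNp _ (Int.fract_nonneg θ) (Int.fract_lt_one θ)
end
end

section
/- Let k ≥ 2 and p ≥ 4 be integers, let l₁, l₂ be integers with 0 < l₁, l₂ < p − 1, let D₁ = {0,…,l₁}, D₂ = {0,…,l₂}, and let K = (K_{p,D₁} × K_{p,D₂}) ∩ [0,1]². Let M = { (x,y) ∈ ℝ² : |x|^k + |y−1|^k = 1 } and d₁ = log(l₁+1)/log p. Then there exists c > 0 such that for every positive integer l, setting δ = p^{−kl}, any cover of M^δ ∩ K by closed balls of radius δ requires at least c·(1/δ)^{(k−1)d₁/k} balls. In particular, M^δ ∩ K cannot be covered by O((1/δ)^{e}) many δ-balls for any e < (k−1)d₁/k. -/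
open MeasureTheory Metric Filter Set
open scoped ENNReal NNReal Real Topology

noncomputable section

/-- The missing digits set in base `p` with digit set `{0,…,m-1}`:
numbers in `[0,1]` of the form `Σ_{i≥1} dᵢ p^{-i}` with all digits `dᵢ < m`. -/
def MDset (p m : ℕ) : Set ℝ :=
  {x | x ∈ Set.Icc (0 : ℝ) 1 ∧
    ∃ d : ℕ → ℕ, (∀ i, d i < m) ∧ x = ∑' i : ℕ, (d i : ℝ) / (p : ℝ) ^ (i + 1)}

lemma MD_zero (p m : ℕ) (hm : 0 < m) : (0:ℝ) ∈ MDset p m :=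
  ⟨by simp, fun _ => 0, fun _ => hm, by simp⟩

lemma MD_cons (p m : ℕ) (hp : 2 ≤ p) (hmp : m ≤ p) (x : ℝ) (hx : x ∈ MDset p m) (d : ℕ)
    (hd : d < m) : ((d:ℝ) + x) / p ∈ MDset p m := by
  obtain ⟨⟨h0, h1⟩, e, he, rfl⟩ := hx
  have hp0 : (0:ℝ) < p := by positivity
  have hp1 : (1:ℝ) < p := by exact_mod_cast (by omega : 1 < p)
  have hs : Summable (fun i : ℕ => (e i : ℝ) / (p:ℝ) ^ (i + 1)) := by
    have hg : Summable (fun i : ℕ => (m:ℝ) * ((p:ℝ)⁻¹) ^ i) :=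
      (summable_geometric_of_lt_one (by positivity) (inv_lt_one_of_one_lt₀ hp1)).mul_left _
    refine Summable.of_nonneg_of_le (fun i => by positivity) (fun i => ?_) hg
    rw [inv_pow, ← div_eq_mul_inv]
    have h1 : (e i : ℝ) ≤ m := by exact_mod_cast (he i).le
    have h2 : (p:ℝ)^i ≤ (p:ℝ)^(i+1) := pow_le_pow_right₀ hp1.le (by omega)
    gcongr
  refine ⟨⟨by positivity, ?_⟩, fun i => Nat.casesOn i d e, ?_, ?_⟩
  · rw [div_le_one hp0]
    have : (d:ℝ) + 1 ≤ p := by exact_mod_cast (by omega : d + 1 ≤ p)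
    linarith
  · intro i
    cases i with
    | zero => exact hd
    | succ i => exact he i
  · have hs' : (fun i : ℕ => (e i : ℝ) / (p:ℝ) ^ (i + 1 + 1))
        = fun i : ℕ => ((e i : ℝ) / (p:ℝ) ^ (i + 1)) * (p:ℝ)⁻¹ := by
      funext i
      rw [pow_succ (p:ℝ) (i+1)]
      field_simp
    rw [Summable.tsum_eq_zero_add
      (f := fun i : ℕ => (((Nat.casesOn i d e : ℕ) : ℕ) : ℝ) / (p:ℝ) ^ (i + 1))]
    · show _ = (d:ℝ) / (p:ℝ)^(0+1) + ∑' i : ℕ, (e i : ℝ) / (p:ℝ) ^ (i + 1 + 1)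
      rw [hs', tsum_mul_right]
      simp
      ring
    · rw [← summable_nat_add_iff 1]
      show Summable (fun i : ℕ => (e i : ℝ) / (p:ℝ) ^ (i + 1 + 1))
      rw [hs']
      exact hs.mul_right _

lemma exists_A (p m : ℕ) (hp : 2 ≤ p) (hmp : m ≤ p) (hm : 0 < m) (n : ℕ) :
    ∃ A : Finset ℕ, A.card = m ^ n ∧ ∀ a ∈ A, a < p ^ n ∧ (a:ℝ) / (p:ℝ)^n ∈ MDset p m := by
  have hp0 : (0:ℝ) < p := by positivity
  induction n with
  | zero =>
    refine ⟨{0}, by simp, ?_⟩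
    intro a ha
    simp at ha
    subst ha
    simpa using MD_zero p m hm
  | succ n ih =>
    obtain ⟨A, hc, hA⟩ := ih
    refine ⟨(Finset.range m ×ˢ A).image (fun q => p ^ n * q.1 + q.2), ?_, ?_⟩
    · rw [Finset.card_image_of_injOn]
      · simp [hc, pow_succ, mul_comm]
      · rintro ⟨d, a⟩ h ⟨d', a'⟩ h' heq
        simp at h h' heq
        have h1 := (hA a h.2).1
        have h2 := (hA a' h'.2).1
        have e1 : d = d' := by
          have := congrArg (· / p ^ n) heq
          simpa [Nat.mul_add_div (by positivity : 0 < p ^ n), Nat.div_eq_of_lt h1,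
            Nat.div_eq_of_lt h2] using this
        subst e1
        simpa using heq
    · intro b hb
      simp only [Finset.mem_image, Finset.mem_product, Finset.mem_range, Prod.exists] at hb
      obtain ⟨d, a, ⟨hd, ha⟩, rfl⟩ := hb
      obtain ⟨h1, h2⟩ := hA a ha
      constructor
      · calc p ^ n * d + a < p ^ n * (d + 1) := by rw [mul_add]; omega
          _ ≤ p ^ n * p := Nat.mul_le_mul_left _ (by omega)
          _ = _ := (pow_succ _ _).symm
      · have := MD_cons p m hp hmp _ h2 d hd
        convert this using 1
        push_cast
        rw [pow_succ]
        field_simp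

lemma MD_shift (p m : ℕ) (hp : 2 ≤ p) (hmp : m ≤ p) (hm : 0 < m) (x : ℝ) (hx : x ∈ MDset p m)
    (j : ℕ) : x / (p:ℝ) ^ j ∈ MDset p m := by
  induction j with
  | zero => simpa using hx
  | succ j ih =>
    have := MD_cons p m hp hmp _ ih 0 hm
    convert this using 1
    rw [pow_succ]
    field_simp
    simp

lemma mem_thick (k : ℕ) (hk : 2 ≤ k) (x δ : ℝ) (hx0 : 0 ≤ x) (hx1 : x ≤ 1) (hδ : x ^ k ≤ δ) :
    (!₂[x, 0] : EuclideanSpace ℝ (Fin 2)) ∈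
      Metric.cthickening δ {v : EuclideanSpace ℝ (Fin 2) | |v 0| ^ k + |v 1 - 1| ^ k = 1} := by
  have hk0 : k ≠ 0 := by omega
  have ht0 : 0 ≤ x ^ k := by positivity
  have ht1 : x ^ k ≤ 1 := pow_le_one₀ hx0 hx1
  set r : ℝ := (1 - x ^ k) ^ ((k:ℝ)⁻¹) with hr
  have hr0 : 0 ≤ r := Real.rpow_nonneg (by linarith) _
  have hrk : r ^ k = 1 - x ^ k := Real.rpow_inv_natCast_pow (by linarith) hk0
  have hr1 : r ≤ 1 := by
    by_contra h
    have := one_lt_pow₀ (not_le.mp h) hk0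
    linarith
  have hrr : 1 - x ^ k ≤ r := by
    rw [← hrk]
    exact pow_le_of_le_one hr0 hr1 hk0
  apply Metric.mem_cthickening_of_dist_le _ (!₂[x, 1 - r] : EuclideanSpace ℝ (Fin 2))
  · simp [abs_of_nonneg hx0, abs_of_nonneg hr0, hrk]
  · rw [EuclideanSpace.dist_eq]
    simp [Fin.sum_univ_two, Real.dist_eq]
    rw [Real.sqrt_sq_eq_abs, abs_le]
    constructor <;> linarith

lemma fiber_card (A : Finset ℕ) (c : ℝ) (h : ∀ a ∈ A, |(a:ℝ) - c| ≤ 1) : A.card ≤ 3 := by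
  have : A ⊆ Finset.Icc ⌈c - 1⌉₊ (⌈c - 1⌉₊ + 2) := by
    intro a ha
    have := abs_le.mp (h a ha)
    rw [Finset.mem_Icc]
    refine ⟨Nat.ceil_le.mpr (by linarith), ?_⟩
    have h2 := Nat.le_ceil (c - 1)
    have : (a:ℝ) ≤ ((⌈c - 1⌉₊ + 2 : ℕ) : ℝ) := by push_cast; linarith
    exact_mod_cast this
  refine (Finset.card_le_card this).trans ?_
  simp
  omega

/-- with `M : |x|^k + |y-1|^k = 1`, `K = K_{p,{0,…,l₁}} × K_{p,{0,…,l₂}}`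
and `d₁ = log(l₁+1)/log p`, there is `c > 0` such that for each `l ≥ 1`, with
`δ = p^{-kl}`, any cover of `M^δ ∩ K` by closed `δ`-balls needs at least
`c (1/δ)^{(k-1)d₁/k}` balls; in particular `M^δ ∩ K` cannot be covered by
`O((1/δ)^e)` many `δ`-balls for any `e < (k-1)d₁/k`. -/
theorem statement13 (k p : ℕ) (hk : 2 ≤ k) (hp : 4 ≤ p)
    (l₁ l₂ : ℕ) (hl₁ : 0 < l₁) (hl₂ : 0 < l₂) (hl₁p : l₁ < p - 1) (hl₂p : l₂ < p - 1)
    (K : Set (EuclideanSpace ℝ (Fin 2)))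
    (hK : K = {v | v 0 ∈ MDset p (l₁ + 1) ∧ v 1 ∈ MDset p (l₂ + 1)})
    (M : Set (EuclideanSpace ℝ (Fin 2)))
    (hM : M = {v | |v 0| ^ k + |v 1 - 1| ^ k = 1})
    (d₁ : ℝ) (hd₁ : d₁ = Real.log (l₁ + 1) / Real.log p) :
    (∃ c : ℝ, 0 < c ∧ ∀ l : ℕ, 1 ≤ l →
      ∀ S : Finset (EuclideanSpace ℝ (Fin 2)),
        Metric.cthickening (((p : ℝ) ^ (k * l))⁻¹) M ∩ K ⊆
          ⋃ x ∈ S, Metric.closedBall x (((p : ℝ) ^ (k * l))⁻¹) →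
        c * ((p : ℝ) ^ (k * l)) ^ (((k : ℝ) - 1) * d₁ / k) ≤ (S.card : ℝ)) ∧
    ∀ e : ℝ, e < ((k : ℝ) - 1) * d₁ / k →
      ¬ ∃ C : ℝ, ∀ l : ℕ, 1 ≤ l →
        ∃ S : Finset (EuclideanSpace ℝ (Fin 2)),
          (S.card : ℝ) ≤ C * ((p : ℝ) ^ (k * l)) ^ e ∧
          Metric.cthickening (((p : ℝ) ^ (k * l))⁻¹) M ∩ K ⊆
            ⋃ x ∈ S, Metric.closedBall x (((p : ℝ) ^ (k * l))⁻¹) := by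
  have hp1 : (1:ℝ) < p := by exact_mod_cast (by omega : 1 < p)
  have hp0 : (0:ℝ) < p := by linarith
  have hkR : (0:ℝ) < k := by exact_mod_cast (by omega : 0 < k)
  have key : ∀ l : ℕ, 1 ≤ l →
      ∀ S : Finset (EuclideanSpace ℝ (Fin 2)),
        Metric.cthickening (((p : ℝ) ^ (k * l))⁻¹) M ∩ K ⊆
          ⋃ x ∈ S, Metric.closedBall x (((p : ℝ) ^ (k * l))⁻¹) →
        (1/3) * ((p : ℝ) ^ (k * l)) ^ (((k : ℝ) - 1) * d₁ / k) ≤ (S.card : ℝ) := by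
    intro l hl S hS
    obtain ⟨j, rfl⟩ : ∃ j, k = j + 1 := ⟨k - 1, by omega⟩
    have hkl : (j + 1) * l = j * l + l := by ring
    obtain ⟨A, hAc, hA⟩ := exists_A p (l₁ + 1) (by omega) (by omega) (by omega) (j * l)
    have hP : (0:ℝ) < (p:ℝ) ^ ((j + 1) * l) := by positivity
    have hmem : ∀ a ∈ A, ∃ s ∈ S, |(a:ℝ) - (p:ℝ) ^ ((j + 1) * l) * s 0| ≤ 1 := by
      intro a ha
      obtain ⟨ha1, ha2⟩ := hA a ha
      have hx : (a:ℝ) / (p:ℝ) ^ ((j + 1) * l) ∈ MDset p (l₁ + 1) := by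
        rw [hkl, pow_add, ← div_div]
        exact MD_shift p _ (by omega) (by omega) (by omega) _ ha2 l
      have hxl : (a:ℝ) / (p:ℝ) ^ ((j + 1) * l) ≤ ((p:ℝ) ^ l)⁻¹ := by
        rw [hkl, pow_add, ← div_div, div_eq_mul_inv _ ((p:ℝ) ^ l)]
        have : (a:ℝ) / (p:ℝ) ^ (j * l) ≤ 1 := by
          rw [div_le_one (by positivity)]
          exact_mod_cast ha1.le
        exact mul_le_of_le_one_left (by positivity) this
      have h1 : (!₂[(a:ℝ) / (p:ℝ) ^ ((j + 1) * l), 0] : EuclideanSpace ℝ (Fin 2)) ∈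
          Metric.cthickening (((p : ℝ) ^ ((j + 1) * l))⁻¹) M ∩ K := by
        constructor
        · rw [hM]
          refine mem_thick _ hk _ _ hx.1.1 hx.1.2 ?_
          calc _ ≤ (((p:ℝ) ^ l)⁻¹) ^ (j + 1) := pow_le_pow_left₀ hx.1.1 hxl _
            _ = _ := by rw [inv_pow, ← pow_mul, mul_comm]
        · rw [hK]
          refine ⟨by simpa using hx, ?_⟩
          simpa using MD_zero p (l₂ + 1) (by omega)
      have h2 := hS h1
      simp only [Set.mem_iUnion, Metric.mem_closedBall] at h2
      obtain ⟨s, hs, hd⟩ := h2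
      refine ⟨s, hs, ?_⟩
      have h3 : |(a:ℝ) / (p:ℝ) ^ ((j + 1) * l) - s 0| ≤ ((p : ℝ) ^ ((j + 1) * l))⁻¹ := by
        have h4 := PiLp.norm_apply_le
          ((!₂[(a:ℝ) / (p:ℝ) ^ ((j + 1) * l), 0] : EuclideanSpace ℝ (Fin 2)) - s) 0
        rw [← dist_eq_norm] at h4
        have h5 := h4.trans hd
        simpa using h5
      have h6 : (a:ℝ) - (p:ℝ) ^ ((j + 1) * l) * s 0
          = (p:ℝ) ^ ((j + 1) * l) * ((a:ℝ) / (p:ℝ) ^ ((j + 1) * l) - s 0) := by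
        field_simp
      rw [h6, abs_mul, abs_of_pos hP]
      calc _ ≤ (p:ℝ) ^ ((j + 1) * l) * ((p : ℝ) ^ ((j + 1) * l))⁻¹ := by gcongr
        _ = 1 := mul_inv_cancel₀ hP.ne'
    choose! f hf1 hf2 using hmem
    have hcard : A.card ≤ 3 * S.card := by
      classical
      refine Finset.card_le_mul_card_image_of_maps_to (f := f) hf1 3 ?_
      intro s hs
      refine fiber_card _ ((p:ℝ) ^ ((j + 1) * l) * s 0) ?_
      intro a ha
      rw [Finset.mem_filter] at ha
      rw [← ha.2]
      exact hf2 a ha.1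
    have hpow : ((p : ℝ) ^ ((j + 1) * l)) ^ ((((j + 1 : ℕ) : ℝ) - 1) * d₁ / ((j + 1 : ℕ) : ℝ))
        = ((l₁:ℝ) + 1) ^ (j * l) := by
      have hpd : (p:ℝ) ^ d₁ = (l₁:ℝ) + 1 := by
        have hlog : Real.log p ≠ 0 := (Real.log_pos hp1).ne'
        rw [Real.rpow_def_of_pos hp0, hd₁, mul_div_cancel₀ _ hlog, Real.exp_log (by positivity)]
      rw [← hpd, ← Real.rpow_natCast, ← Real.rpow_natCast, ← Real.rpow_mul hp0.le,
        ← Real.rpow_mul hp0.le]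
      congr 1
      push_cast
      field_simp
      ring
    rw [hpow]
    have : (A.card : ℝ) ≤ 3 * S.card := by exact_mod_cast hcard
    rw [hAc] at this
    push_cast at this
    linarith
  refine ⟨⟨1/3, by norm_num, key⟩, ?_⟩
  rintro e he ⟨C, hC⟩
  set E := ((k : ℝ) - 1) * d₁ / k with hE
  have hb : ∀ l : ℕ, 1 ≤ l → ((p:ℝ) ^ (E - e)) ^ l ≤ 3 * C := by
    intro l hl
    obtain ⟨S, hS1, hS2⟩ := hC l hl
    have h := (key l hl S hS2).trans hS1
    have hP : (0:ℝ) < (p:ℝ) ^ (k * l) := by positivity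
    have h1 : ((p:ℝ) ^ (k * l)) ^ (E - e) ≤ 3 * C := by
      rw [Real.rpow_sub hP, div_le_iff₀ (Real.rpow_pos_of_pos hP _)]
      linarith
    refine le_trans ?_ h1
    rw [← Real.rpow_natCast, ← Real.rpow_mul hp0.le, mul_comm, Real.rpow_mul hp0.le,
      Real.rpow_natCast]
    refine Real.rpow_le_rpow (by positivity) ?_ (by linarith)
    exact pow_le_pow_right₀ hp1.le (Nat.le_mul_of_pos_left _ (by omega))
  have hgt : 1 < (p:ℝ) ^ (E - e) := Real.one_lt_rpow hp1 (by linarith)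
  obtain ⟨n, hn⟩ := pow_unbounded_of_one_lt (3 * C) hgt
  have h1 := hb (n + 1) (by omega)
  have h2 : ((p:ℝ) ^ (E - e)) ^ n ≤ ((p:ℝ) ^ (E - e)) ^ (n + 1) :=
    pow_le_pow_right₀ hgt.le (by omega)
  linarith
end
end

section
/- Let b = 10^9000, m = 10^7000, and let K₂ = { x ∈ [0,1] : x = Σ_{i≥1} d_i b^{−i} for some sequence of integers d_i with 0 ≤ d_i ≤ m − 1 }. Let K = K₂ × K₂ ⊆ [0,1]². Then for every x ∈ ℝ², the pinned distance set Δ_x(K) = { |x − y| : y ∈ K } (Euclidean distance) contains a nonempty open interval; in particular it has positive Lebesgue measure. -/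
open MeasureTheory Metric Filter Set
open scoped ENNReal NNReal Real Topology

noncomputable section

/-- finite digit strings, as integers -/
def PP (b m : ℕ) : ℕ → Finset ℕ
  | 0 => {0}
  | n + 1 => ((PP b m n) ×ˢ (Finset.range m)).image (fun z => z.1 * b + z.2)

lemma sum_PP_succ {E : Type*} [AddCommMonoid E] {b m : ℕ} (hmb : m ≤ b) (n : ℕ) (F : ℕ → E) :
    ∑ Q ∈ PP b m (n + 1), F Q = ∑ Q ∈ PP b m n, ∑ a ∈ Finset.range m, F (Q * b + a) := by
  rw [PP, Finset.sum_image, Finset.sum_product]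
  rintro ⟨Q, a⟩ h1 ⟨Q', a'⟩ h2 h
  simp only [Finset.coe_product, Finset.coe_range, Set.mem_prod, Set.mem_Iio, SetLike.mem_coe] at h1 h2 h
  have ha : a < b := by omega
  have ha' : a' < b := by omega
  have e1 : (Q * b + a) % b = a := by rw [mul_comm, Nat.mul_add_mod, Nat.mod_eq_of_lt ha]
  have e2 : (Q' * b + a') % b = a' := by rw [mul_comm, Nat.mul_add_mod, Nat.mod_eq_of_lt ha']
  have haa : a = a' := by rw [← e1, h, e2]
  subst haa
  have hQ : Q * b = Q' * b := by omega
  have : Q = Q' := Nat.eq_of_mul_eq_mul_right (by omega) hQ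
  simp [this]

lemma sum_PP_add {E : Type*} [AddCommMonoid E] {b m : ℕ} (hmb : m ≤ b) (k n : ℕ) (F : ℕ → E) :
    ∑ Q ∈ PP b m (k + n), F Q = ∑ Q ∈ PP b m k, ∑ R ∈ PP b m n, F (Q * b ^ n + R) := by
  induction n generalizing F with
  | zero => simp [PP]
  | succ n ih =>
    rw [← add_assoc, sum_PP_succ hmb, ih]
    refine Finset.sum_congr rfl fun Q _ => ?_
    rw [sum_PP_succ hmb]
    refine Finset.sum_congr rfl fun R _ => Finset.sum_congr rfl fun a _ => ?_
    congr 1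
    ring

lemma PP_lt {b m : ℕ} (hmb : m ≤ b) (n : ℕ) : ∀ Q ∈ PP b m n, Q < b ^ n := by
  induction n with
  | zero => simp [PP]
  | succ n ih =>
    intro Q hQ
    simp only [PP, Finset.mem_image, Finset.mem_product, Finset.mem_range, Prod.exists] at hQ
    obtain ⟨Q', a, ⟨h1, h2⟩, rfl⟩ := hQ
    have := ih Q' h1
    calc Q' * b + a < Q' * b + b := by omega
      _ = (Q' + 1) * b := by ring
      _ ≤ b ^ n * b := Nat.mul_le_mul_right _ this
      _ = b ^ (n + 1) := by ring

lemma mem_PP_succ {b m n Q a : ℕ} (hQ : Q ∈ PP b m n) (ha : a < m) : Q * b + a ∈ PP b m (n + 1) := by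
  simp only [PP, Finset.mem_image, Finset.mem_product, Finset.mem_range, Prod.exists]
  exact ⟨Q, a, ⟨hQ, ha⟩, rfl⟩

lemma mem_PP_add {b m k n Q R : ℕ} (hQ : Q ∈ PP b m k) (hR : R ∈ PP b m n) :
    Q * b ^ n + R ∈ PP b m (k + n) := by
  induction n generalizing R with
  | zero => simp [PP] at hR; simpa [hR] using hQ
  | succ n ih =>
    simp only [PP, Finset.mem_image, Finset.mem_product, Finset.mem_range, Prod.exists] at hR
    obtain ⟨Q', a, ⟨h1, h2⟩, rfl⟩ := hR
    have := mem_PP_succ (ih h1) h2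
    rw [show Q * b ^ (n + 1) + (Q' * b + a) = (Q * b ^ n + Q') * b + a by ring]
    exact this

lemma card_PP {b m : ℕ} (hmb : m ≤ b) (n : ℕ) : (PP b m n).card = m ^ n := by
  induction n with
  | zero => simp [PP]
  | succ n ih =>
    rw [Finset.card_eq_sum_ones, sum_PP_succ hmb]
    simp [ih, pow_succ]

lemma zero_mem_PP {b m : ℕ} (hm : 0 < m) (n : ℕ) : 0 ∈ PP b m n := by
  induction n with
  | zero => simp [PP]
  | succ n ih => simpa using mem_PP_succ ih hm

lemma sum_range_mul' {E : Type*} [AddCommMonoid E] (b N : ℕ) (F : ℕ → E) :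
    ∑ Q ∈ Finset.range (N * b), F Q = ∑ Q ∈ Finset.range N, ∑ a ∈ Finset.range b, F (Q * b + a) := by
  induction N with
  | zero => simp
  | succ N ih => rw [add_mul, one_mul, Finset.sum_range_add, ih, Finset.sum_range_succ]

lemma sum_PP_le {b m : ℕ} (hmb : m ≤ b) (n : ℕ) (F : ℕ → ℝ) (hF : ∀ Q, 0 ≤ F Q) :
    ∑ Q ∈ PP b m n, F Q ≤ ∑ Q ∈ Finset.range (b ^ n), F Q := by
  refine Finset.sum_le_sum_of_subset_of_nonneg ?_ (fun _ _ _ => hF _)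
  intro Q hQ
  simpa using PP_lt hmb n Q hQ

/-! ### The Cantor set -/

lemma MD_summable {b m : ℕ} (hb : 2 ≤ b) (d : ℕ → ℕ) (hd : ∀ i, d i < m) :
    Summable (fun i : ℕ => (d i : ℝ) / (b : ℝ) ^ (i + 1)) := by
  have hb' : (1 : ℝ) < b := by exact_mod_cast hb
  have h : Summable (fun i : ℕ => (m : ℝ) * ((1 / b : ℝ)) ^ (i + 1)) := by
    refine Summable.mul_left _ ?_
    exact (summable_nat_add_iff 1).2 (summable_geometric_of_lt_one (by positivity)
      (by rw [div_lt_one (by linarith)]; exact hb'))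
  refine Summable.of_nonneg_of_le (fun i => by positivity) (fun i => ?_) h
  rw [one_div, inv_pow, ← div_eq_mul_inv]
  gcongr
  exact_mod_cast (hd i).le

lemma MD_bound {b m : ℕ} (hb : 2 ≤ b) (hmb : m ≤ b) (d : ℕ → ℕ) (hd : ∀ i, d i < m) :
    ∑' i : ℕ, (d i : ℝ) / (b : ℝ) ^ (i + 1) ∈ Set.Icc (0 : ℝ) 1 := by
  have hb' : (1 : ℝ) < b := by exact_mod_cast hb
  refine ⟨tsum_nonneg fun i => by positivity, ?_⟩
  have hg : HasSum (fun i : ℕ => ((b : ℝ) - 1) / b * (1 / b : ℝ) ^ i) 1 := by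
    have := (hasSum_geometric_of_lt_one (r := (1 / b : ℝ)) (by positivity)
      (by rw [div_lt_one (by linarith)]; exact hb')).mul_left (((b : ℝ) - 1) / b)
    have h1 : (b : ℝ) - 1 ≠ 0 := by linarith
    have h2 : (b : ℝ) ≠ 0 := by linarith
    have h3 : (1 : ℝ) - 1 / b = (b - 1) / b := by field_simp
    rw [h3, inv_div, div_mul_div_cancel₀ h2, div_self h1] at this
    exact this
  rw [← hg.tsum_eq]
  refine (MD_summable hb d hd).tsum_le_tsum (fun i => ?_) hg.summable
  have : (d i : ℝ) ≤ b - 1 := by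
    have h1 : d i + 1 ≤ b := by have := hd i; omega
    have : ((d i + 1 : ℕ) : ℝ) ≤ b := by exact_mod_cast h1
    push_cast at this; linarith
  calc (d i : ℝ) / (b : ℝ) ^ (i + 1) ≤ (b - 1) / (b : ℝ) ^ (i + 1) := by gcongr
    _ = _ := by rw [pow_succ, one_div, inv_pow]; field_simp

lemma isCompact_MDset {b m : ℕ} (hb : 2 ≤ b) (hmb : m ≤ b) : IsCompact (MDset b m) := by
  have hb' : (1 : ℝ) < b := by exact_mod_cast hb
  have : MDset b m = (fun w : ℕ → Fin m => ∑' i : ℕ, ((w i : ℕ) : ℝ) / (b : ℝ) ^ (i + 1)) '' Set.univ := by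
    ext x
    constructor
    · rintro ⟨_, d, hd, rfl⟩
      exact ⟨fun i => ⟨d i, hd i⟩, trivial, rfl⟩
    · rintro ⟨w, _, rfl⟩
      exact ⟨MD_bound hb hmb (fun i => w i) (fun i => (w i).2), fun i => w i, fun i => (w i).2, rfl⟩
  rw [this]
  refine isCompact_univ.image ?_
  have h : Summable (fun i : ℕ => (m : ℝ) * ((1 / b : ℝ)) ^ (i + 1)) := by
    refine Summable.mul_left _ ?_
    exact (summable_nat_add_iff 1).2 (summable_geometric_of_lt_one (by positivity)
      (by rw [div_lt_one (by linarith)]; exact hb'))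
  refine continuous_tsum (fun i => ?_) h (fun i w => ?_)
  · refine Continuous.div_const ?_ _
    exact (continuous_of_discreteTopology (f := fun z : Fin m => ((z : ℕ) : ℝ))).comp (continuous_apply i)
  · rw [Real.norm_of_nonneg (by positivity), one_div, inv_pow, ← div_eq_mul_inv]
    gcongr
    exact_mod_cast (w i).2.le

lemma PP_digits {b m : ℕ} (hb : 2 ≤ b) (hm : 0 < m) (n : ℕ) : ∀ Q ∈ PP b m n, ∃ d : ℕ → ℕ,
    (∀ i, d i < m) ∧ (∀ i, n ≤ i → d i = 0) ∧
      (Q : ℝ) / (b : ℝ) ^ n = ∑ i ∈ Finset.range n, (d i : ℝ) / (b : ℝ) ^ (i + 1) := by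
  have hb' : (0 : ℝ) < b := by exact_mod_cast (by omega : 0 < b)
  induction n with
  | zero =>
    intro Q hQ
    simp [PP] at hQ
    exact ⟨fun _ => 0, fun _ => hm, fun _ _ => rfl, by simp [hQ]⟩
  | succ n ih =>
    intro Q hQ
    simp only [PP, Finset.mem_image, Finset.mem_product, Finset.mem_range, Prod.exists] at hQ
    obtain ⟨Q', a, ⟨h1, h2⟩, rfl⟩ := hQ
    obtain ⟨d, hd, hd0, hdQ⟩ := ih Q' h1
    refine ⟨Function.update d n a, fun i => ?_, fun i hi => ?_, ?_⟩
    · by_cases h : i = n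
      · subst h; simpa using h2
      · simpa [h] using hd i
    · rw [Function.update_of_ne (by omega)]
      exact hd0 i (by omega)
    · rw [Finset.sum_range_succ, Function.update_self]
      rw [Finset.sum_congr rfl (g := fun i => (d i : ℝ) / (b : ℝ) ^ (i + 1))
        (fun i hi => by rw [Function.update_of_ne (by simp at hi; omega)]), ← hdQ]
      push_cast
      rw [pow_succ]
      field_simp

lemma PP_mem_MDset {b m : ℕ} (hb : 2 ≤ b) (hm : 0 < m) (hmb : m ≤ b) (n : ℕ) (Q : ℕ)
    (hQ : Q ∈ PP b m n) : (Q : ℝ) / (b : ℝ) ^ n ∈ MDset b m := by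
  obtain ⟨d, hd, hd0, hdQ⟩ := PP_digits hb hm n Q hQ
  have : (Q : ℝ) / (b : ℝ) ^ n = ∑' i : ℕ, (d i : ℝ) / (b : ℝ) ^ (i + 1) := by
    rw [hdQ, tsum_eq_sum]
    intro i hi
    simp only [Finset.mem_range, not_lt] at hi
    simp [hd0 i hi]
  exact ⟨this ▸ MD_bound hb hmb d hd, d, hd, this⟩
/-! ### Exponential sums -/

/-- `e(x)` -/
def ee (x : ℝ) : ℂ := Complex.exp ((2 * π * x : ℝ) * Complex.I)

lemma norm_ee (x : ℝ) : ‖ee x‖ = 1 := Complex.norm_exp_ofReal_mul_I _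

lemma ee_add (x y : ℝ) : ee (x + y) = ee x * ee y := by
  rw [ee, ee, ee, ← Complex.exp_add]; congr 1; push_cast; ring

lemma ee_zero : ee 0 = 1 := by simp [ee]

lemma ee_nat (n : ℕ) : ee n = 1 := by
  rw [ee, Complex.exp_eq_one_iff]
  exact ⟨n, by push_cast; ring⟩

lemma ee_mul_nat (x : ℝ) (n : ℕ) : ee (n * x) = ee x ^ n := by
  rw [ee, ee, ← Complex.exp_nat_mul]; congr 1; push_cast; ring

@[fun_prop] lemma continuous_ee : Continuous ee := by unfold ee; fun_prop

lemma norm_ee_sub_one_le (x : ℝ) : ‖ee x - 1‖ ≤ 2 * π * |x| := by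
  have := Real.norm_exp_I_mul_ofReal_sub_one_le (x := 2 * π * x)
  rw [ee, mul_comm]
  refine this.trans ?_
  rw [Real.norm_eq_abs, abs_mul, abs_of_pos Real.two_pi_pos]

/-- normalised Dirichlet kernel -/
def DD (m : ℕ) (u : ℝ) : ℂ := (1 / m : ℂ) * ∑ j ∈ Finset.range m, ee (j * u)

/-- finite level Fourier transform -/
def psi (b m n : ℕ) (l : ℝ) : ℂ := (1 / m ^ n : ℂ) * ∑ Q ∈ PP b m n, ee (l * (Q / (b : ℝ) ^ n))

@[fun_prop] lemma continuous_DD (m : ℕ) : Continuous (DD m) := by unfold DD; fun_prop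
@[fun_prop] lemma continuous_psi (b m n : ℕ) : Continuous (psi b m n) := by unfold psi; fun_prop

lemma norm_DD_le_one (m : ℕ) (u : ℝ) : ‖DD m u‖ ≤ 1 := by
  rw [DD, norm_mul]
  have : ‖∑ j ∈ Finset.range m, ee (j * u)‖ ≤ m := by
    refine (norm_sum_le _ _).trans ?_
    simp [norm_ee]
  have h2 : ‖(1 / m : ℂ)‖ = 1 / m := by simp
  rw [h2]
  rcases Nat.eq_zero_or_pos m with h | h
  · simp [h]
  · have : (0:ℝ) < m := by exact_mod_cast h
    rw [div_mul_eq_mul_div, one_mul, div_le_one this]; assumption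

lemma DD_add_nat (m : ℕ) (u : ℝ) (c : ℕ) : DD m (c + u) = DD m u := by
  unfold DD
  congr 1
  refine Finset.sum_congr rfl fun j _ => ?_
  rw [mul_add, ee_add]
  have := ee_nat (j * c)
  push_cast at this
  rw [this, one_mul]

lemma ee_neg (x : ℝ) : ee (-x) = starRingEnd ℂ (ee x) := by
  rw [ee, ee, ← Complex.exp_conj, map_mul, Complex.conj_ofReal, Complex.conj_I]; congr 1; push_cast; ring

lemma norm_DD_neg (m : ℕ) (u : ℝ) : ‖DD m (-u)‖ = ‖DD m u‖ := by
  have : DD m (-u) = starRingEnd ℂ (DD m u) := by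
    simp only [DD, map_mul, map_sum, mul_neg, ee_neg]
    simp
  rw [this, Complex.norm_conj]

lemma norm_DD_abs (m : ℕ) (u : ℝ) : ‖DD m |u|‖ = ‖DD m u‖ := by
  rcases abs_choice u with h | h <;> rw [h]
  exact norm_DD_neg m u

lemma psi_succ {b m : ℕ} (hb : 0 < b) (hmb : m ≤ b) (n : ℕ) (l : ℝ) :
    psi b m (n + 1) l = psi b m n l * DD m (l / (b : ℝ) ^ (n + 1)) := by
  have hb' : (b : ℝ) ≠ 0 := by positivity
  rw [psi, psi, DD, sum_PP_succ hmb, mul_mul_mul_comm, Finset.sum_mul_sum]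
  congr 1
  · rw [pow_succ]; ring
  · refine Finset.sum_congr rfl fun Q _ => Finset.sum_congr rfl fun a _ => ?_
    rw [← ee_add]
    congr 1
    push_cast
    rw [pow_succ]
    field_simp

lemma psi_eq_prod {b m : ℕ} (hb : 0 < b) (hmb : m ≤ b) (n : ℕ) (l : ℝ) :
    psi b m n l = ∏ i ∈ Finset.range n, DD m (l / (b : ℝ) ^ (i + 1)) := by
  induction n with
  | zero => simp [psi, PP, ee_zero]
  | succ n ih => rw [psi_succ hb hmb, Finset.prod_range_succ, ih]

lemma psi_add {b m : ℕ} (hb : 0 < b) (hmb : m ≤ b) (r n : ℕ) (l : ℝ) :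
    psi b m (r + n) l = psi b m r l * psi b m n (l / (b : ℝ) ^ r) := by
  rw [psi_eq_prod hb hmb, psi_eq_prod hb hmb, psi_eq_prod hb hmb, Finset.prod_range_add]
  congr 1
  refine Finset.prod_congr rfl fun i _ => ?_
  rw [div_div, ← pow_add, add_assoc]

lemma norm_psi_le_one {b m : ℕ} (hb : 0 < b) (hmb : m ≤ b) (n : ℕ) (l : ℝ) : ‖psi b m n l‖ ≤ 1 := by
  rw [psi_eq_prod hb hmb, norm_prod]
  exact Finset.prod_le_one (fun _ _ => norm_nonneg _) (fun _ _ => norm_DD_le_one _ _)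

lemma norm_psi_anti {b m : ℕ} (hb : 0 < b) (hmb : m ≤ b) {k n : ℕ} (h : k ≤ n) (l : ℝ) :
    ‖psi b m n l‖ ≤ ‖psi b m k l‖ := by
  obtain ⟨r, rfl⟩ := Nat.exists_eq_add_of_le h
  rw [psi_add hb hmb, norm_mul]
  exact mul_le_of_le_one_right (norm_nonneg _) (norm_psi_le_one hb hmb _ _)

lemma norm_DD_sub_one_le {m : ℕ} (hm : 0 < m) (u : ℝ) : ‖DD m u - 1‖ ≤ 2 * π * m * |u| := by
  have hm' : (0 : ℝ) < m := by exact_mod_cast hm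
  have hmc : (m : ℂ) ≠ 0 := by exact_mod_cast hm.ne'
  have : DD m u - 1 = (1 / m : ℂ) * ∑ j ∈ Finset.range m, (ee (j * u) - 1) := by
    rw [Finset.sum_sub_distrib, mul_sub, DD]; simp [hmc]
  rw [this, norm_mul]
  have h1 : ‖∑ j ∈ Finset.range m, (ee (j * u) - 1)‖ ≤ ∑ j ∈ Finset.range m, 2 * π * m * |u| := by
    refine norm_sum_le_of_le _ fun j hj => ?_
    refine (norm_ee_sub_one_le _).trans ?_
    rw [abs_mul, Nat.abs_cast, ← mul_assoc]
    have : (j : ℝ) ≤ m := by exact_mod_cast (Finset.mem_range.1 hj).le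
    gcongr
  have h2 : ‖(1 / m : ℂ)‖ = 1 / m := by simp
  rw [h2]
  calc (1 / m : ℝ) * _ ≤ (1 / m : ℝ) * (∑ j ∈ Finset.range m, 2 * π * m * |u|) := by gcongr
    _ = _ := by rw [Finset.sum_const, Finset.card_range, nsmul_eq_mul]; field_simp

lemma exists_Psi {b m : ℕ} (hb : 2 ≤ b) (hm : 0 < m) (hmb : m ≤ b) :
    ∃ Psi : ℝ → ℂ, ∀ l, Tendsto (fun n => psi b m n l) atTop (𝓝 (Psi l)) := by
  have hb' : (1 : ℝ) < b := by exact_mod_cast hb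
  have hb0 : 0 < b := by omega
  have : ∀ l, ∃ z, Tendsto (fun n => psi b m n l) atTop (𝓝 z) := by
    intro l
    refine cauchySeq_tendsto_of_complete ?_
    refine cauchySeq_of_le_geometric (1 / b : ℝ) (2 * π * m * |l| / b) 
      (by rw [div_lt_one (by linarith)]; exact hb') fun n => ?_
    rw [dist_comm, dist_eq_norm, psi_succ hb0 hmb, ← mul_sub_one, norm_mul]
    refine (mul_le_of_le_one_left (norm_nonneg _) (norm_psi_le_one hb0 hmb _ _)).trans ?_
    refine (norm_DD_sub_one_le hm _).trans (le_of_eq ?_)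
    rw [abs_div, abs_of_pos (by positivity : (0:ℝ) < (b:ℝ)^(n+1)), pow_succ, one_div, inv_pow]
    field_simp
  choose Psi h using this
  exact ⟨Psi, h⟩
/-! ### Bounds for the exponential sums -/

lemma norm_DD_le_aux {m : ℕ} (hm : 0 < m) (u : ℝ) (h0 : 0 < u) (h1 : u < 1) :
    ‖DD m u‖ ≤ 1 / (2 * m) * (1 / u + 1 / (1 - u)) := by
  have hm' : (0 : ℝ) < m := by exact_mod_cast hm
  have h1u : 0 < 1 - u := by linarith
  have hsum : (∑ j ∈ Finset.range m, ee (j * u)) * (ee u - 1) = ee u ^ m - 1 := by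
    rw [← geom_sum_mul]; simp only [ee_mul_nat]
  have hn : ‖ee u - 1‖ = 2 * Real.sin (π * u) := by
    rw [ee, mul_comm, Complex.norm_exp_I_mul_ofReal_sub_one, Real.norm_of_nonneg]
    · congr 2; ring
    · refine mul_nonneg (by norm_num) (Real.sin_nonneg_of_nonneg_of_le_pi (by positivity) ?_)
      nlinarith [Real.pi_pos]
  have hs : 2 * (u * (1 - u)) ≤ Real.sin (π * u) := by
    rcases le_total u (1/2) with h | h
    · have := Real.mul_le_sin (x := π * u) (by positivity) (by nlinarith [Real.pi_pos])
      rw [div_mul_eq_mul_div, mul_left_comm, mul_div_cancel_left₀ _ Real.pi_ne_zero] at this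
      nlinarith
    · have := Real.mul_le_sin (x := π * (1 - u)) (by positivity) (by nlinarith [Real.pi_pos])
      rw [div_mul_eq_mul_div, mul_left_comm, mul_div_cancel_left₀ _ Real.pi_ne_zero,
        show π * (1 - u) = π - π * u by ring, Real.sin_pi_sub] at this
      nlinarith
  have huu : 0 < u * (1 - u) := by positivity
  have hle : ‖∑ j ∈ Finset.range m, ee (j * u)‖ * (4 * (u * (1 - u))) ≤ 2 := by
    calc _ ≤ ‖∑ j ∈ Finset.range m, ee (j * u)‖ * ‖ee u - 1‖ := by
          rw [hn]; exact mul_le_mul_of_nonneg_left (by linarith) (norm_nonneg _)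
      _ = ‖ee u ^ m - 1‖ := by rw [← norm_mul, hsum]
      _ ≤ ‖ee u ^ m‖ + ‖(1 : ℂ)‖ := norm_sub_le _ _
      _ = 2 := by rw [norm_pow, norm_ee]; norm_num
  have e : 1 / (2 * (m : ℝ)) * (1 / u + 1 / (1 - u)) = (1 / m) * (2 / (4 * (u * (1 - u)))) := by
    field_simp; ring
  rw [e, DD, norm_mul]
  have h2 : ‖(1 / m : ℂ)‖ = 1 / m := by simp
  rw [h2]
  gcongr
  rw [le_div_iff₀ (by positivity)]
  exact hle

/-- digit weights -/
def gg (b m a : ℕ) : ℝ :=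
  if a = 0 ∨ a + 1 = b then 1 else (b / (2 * m)) * (1 / (a : ℝ) + 1 / ((b : ℝ) - 1 - a))

lemma gg_nonneg {b m a : ℕ} (ha : a < b) : 0 ≤ gg b m a := by
  unfold gg
  split_ifs with h
  · norm_num
  · have : (a : ℝ) + 1 ≤ b := by exact_mod_cast ha
    have : 0 ≤ (b : ℝ) - 1 - a := by linarith
    positivity

lemma norm_DD_le_gg {b m : ℕ} (hm : 0 < m) {a : ℕ} (ha : a < b) {v : ℝ} (hv0 : 0 ≤ v) (hv1 : v ≤ 1) :
    ‖DD m ((a + v) / b)‖ ≤ gg b m a := by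
  unfold gg
  split_ifs with h
  · exact norm_DD_le_one _ _
  · push Not at h
    have hb : (0 : ℝ) < b := by exact_mod_cast (by omega : 0 < b)
    have hm' : (0 : ℝ) < m := by exact_mod_cast hm
    have ha1 : (1 : ℝ) ≤ a := by exact_mod_cast (by omega : 1 ≤ a)
    have ha2 : (a : ℝ) + 2 ≤ b := by exact_mod_cast (by omega : a + 2 ≤ b)
    have hu0 : 0 < (a + v) / b := by positivity
    have hu1 : (a + v) / b < 1 := by rw [div_lt_one hb]; linarith
    refine (norm_DD_le_aux hm _ hu0 hu1).trans ?_
    have e1 : 1 / ((a + v) / b) ≤ b * (1 / (a : ℝ)) := by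
      rw [one_div_div, div_eq_mul_one_div]
      gcongr
      linarith
    have e2 : 1 / (1 - (a + v) / b) ≤ b * (1 / ((b : ℝ) - 1 - a)) := by
      rw [show 1 - (a + v) / b = (b - a - v) / b by field_simp; ring, one_div_div, div_eq_mul_one_div]
      have : 0 < (b : ℝ) - 1 - a := by linarith
      exact mul_le_mul_of_nonneg_left (one_div_le_one_div_of_le this (by linarith)) hb.le
    calc _ ≤ 1 / (2 * (m : ℝ)) * (b * (1 / (a : ℝ)) + b * (1 / ((b : ℝ) - 1 - a))) := by gcongr
      _ = _ := by ring

/-- cell weights -/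
def WW (b m k j : ℕ) : ℝ := ∏ i ∈ Finset.range k, gg b m (j / b ^ i % b)

lemma WW_nonneg {b m : ℕ} (hb : 0 < b) (k j : ℕ) : 0 ≤ WW b m k j :=
  Finset.prod_nonneg fun _ _ => gg_nonneg (Nat.mod_lt _ hb)

lemma norm_psi_le_WW {b m : ℕ} (hb : 0 < b) (hm : 0 < m) (hmb : m ≤ b) (k : ℕ) (l : ℝ) :
    ‖psi b m k l‖ ≤ WW b m k ⌊|l|⌋₊ := by
  rw [psi_eq_prod hb hmb, norm_prod, WW]
  refine Finset.prod_le_prod (fun _ _ => norm_nonneg _) fun i _ => ?_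
  have hb' : (0 : ℝ) < b := by exact_mod_cast hb
  have hbi : (0 : ℝ) < (b : ℝ) ^ i := by positivity
  rw [← norm_DD_abs, abs_div, abs_of_pos (by positivity : (0:ℝ) < (b : ℝ) ^ (i + 1))]
  set L := |l| with hL
  have hfl : ⌊L / (b : ℝ) ^ i⌋₊ = ⌊L⌋₊ / b ^ i := by
    have := Nat.floor_div_natCast (K := ℝ) L (b ^ i)
    push_cast at this
    exact this
  set A := ⌊L⌋₊ / b ^ i with hA
  have hnn : 0 ≤ L / (b : ℝ) ^ i := by positivity
  have h1 : (A : ℝ) ≤ L / (b : ℝ) ^ i := by rw [← hfl]; exact Nat.floor_le hnn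
  have h2 : L / (b : ℝ) ^ i ≤ A + 1 := by rw [← hfl]; exact (Nat.lt_floor_add_one _).le
  have hdm : (A : ℝ) = b * (A / b : ℕ) + (A % b : ℕ) := by
    exact_mod_cast (Nat.div_add_mod A b).symm
  have key : L / (b : ℝ) ^ (i + 1) = (A / b : ℕ) + ((A % b : ℕ) + (L / (b : ℝ) ^ i - A)) / b := by
    rw [hdm, pow_succ]; field_simp; ring
  rw [key, DD_add_nat]
  exact norm_DD_le_gg hm (Nat.mod_lt _ hb) (by linarith) (by linarith)

/-- the total weight -/
def GG (b m : ℕ) : ℝ := ∑ a ∈ Finset.range b, gg b m a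

lemma sum_WW {b m : ℕ} (hb : 0 < b) (k : ℕ) :
    ∑ j ∈ Finset.range (b ^ k), WW b m k j = GG b m ^ k := by
  induction k with
  | zero => simp [WW]
  | succ k ih =>
    rw [pow_succ, sum_range_mul', pow_succ, ← ih, GG, Finset.sum_mul_sum]
    refine Finset.sum_congr rfl fun Q _ => Finset.sum_congr rfl fun a ha => ?_
    have ha' : a < b := Finset.mem_range.1 ha
    rw [WW, Finset.prod_range_succ', WW]
    congr 1
    · refine Finset.prod_congr rfl fun i _ => ?_
      congr 2
      rw [pow_succ', ← Nat.div_div_eq_div_mul]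
      congr 1
      rw [mul_comm, Nat.mul_add_div hb, Nat.div_eq_of_lt ha', add_zero]
    · rw [pow_zero, Nat.div_one, mul_comm, Nat.mul_add_mod, Nat.mod_eq_of_lt ha']

lemma GG_nonneg (b m : ℕ) : 0 ≤ GG b m :=
  Finset.sum_nonneg fun _ ha => gg_nonneg (Finset.mem_range.1 ha)

lemma one_le_GG {b m : ℕ} (hb : 0 < b) : 1 ≤ GG b m := by
  have : gg b m 0 ≤ GG b m := Finset.single_le_sum (f := gg b m)
    (fun _ ha => gg_nonneg (Finset.mem_range.1 ha)) (Finset.mem_range.2 hb)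
  simpa [gg] using this

lemma GG_le {b m : ℕ} (hb : 2 ≤ b) : GG b m ≤ 2 + (b / m) * (1 + Real.log b) := by
  have hH : ∑ a ∈ Finset.range b, 1 / (a : ℝ) ≤ 1 + Real.log b := by
    obtain ⟨c, rfl⟩ : ∃ c, b = c + 1 := ⟨b - 1, by omega⟩
    rw [Finset.sum_range_succ']
    have := harmonic_le_one_add_log c
    rw [harmonic] at this
    push_cast at this
    have hl : Real.log c ≤ Real.log ((c + 1 : ℕ) : ℝ) := by
      apply Real.log_le_log
      · exact_mod_cast (by omega : 0 < c)
      · push_cast; linarith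
    simp only [one_div]
    push_cast at hl ⊢
    simp only [inv_zero]
    linarith
  have hR : ∑ a ∈ Finset.range b, 1 / ((b : ℝ) - 1 - a) = ∑ a ∈ Finset.range b, 1 / (a : ℝ) := by
    rw [← Finset.sum_range_reflect]
    refine Finset.sum_congr rfl fun a ha => ?_
    have : a + 1 ≤ b := Finset.mem_range.1 ha
    rw [Nat.cast_sub (by omega), Nat.cast_sub (by omega)]
    push_cast
    congr 1
    ring
  have hle : ∀ a ∈ Finset.range b, gg b m a ≤ (if a = 0 then 1 else 0) + (if a = b - 1 then 1 else 0) +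
      (b / (2 * m)) * (1 / (a : ℝ) + 1 / ((b : ℝ) - 1 - a)) := by
    intro a ha
    have ha' : a + 1 ≤ b := Finset.mem_range.1 ha
    have h0 : 0 ≤ (b : ℝ) - 1 - a := by
      have : (a : ℝ) + 1 ≤ b := by exact_mod_cast ha'
      linarith
    have hp : 0 ≤ (b / (2 * m) : ℝ) * (1 / (a : ℝ) + 1 / ((b : ℝ) - 1 - a)) := by positivity
    unfold gg
    split_ifs <;> first | omega | linarith
  refine (Finset.sum_le_sum hle).trans ?_
  rw [Finset.sum_add_distrib, Finset.sum_add_distrib, ← Finset.mul_sum, Finset.sum_add_distrib, hR]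
  rw [Finset.sum_ite_eq' , Finset.sum_ite_eq']
  rw [if_pos (by simp; omega), if_pos (by simp; omega)]
  have : (b / (2 * m) : ℝ) * (∑ a ∈ Finset.range b, 1 / (a : ℝ) + ∑ a ∈ Finset.range b, 1 / (a : ℝ))
     = (b / m : ℝ) * ∑ a ∈ Finset.range b, 1 / (a : ℝ) := by ring
  rw [this]
  have : (b / m : ℝ) * ∑ a ∈ Finset.range b, 1 / (a : ℝ) ≤ (b / m : ℝ) * (1 + Real.log b) := by gcongr
  linarith
/-! ### Averaging over the slope -/

lemma card_le_of_diam (S : Finset ℕ) (D : ℕ) (h : ∀ x ∈ S, ∀ y ∈ S, x ≤ y + D) : S.card ≤ D + 1 := by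
  rcases S.eq_empty_or_nonempty with rfl | hS
  · simp
  · have : S ⊆ Finset.Icc (S.min' hS) (S.min' hS + D) := by
      intro x hx
      exact Finset.mem_Icc.2 ⟨S.min'_le x hx, h x hx _ (S.min'_mem hS)⟩
    have := Finset.card_le_card this
    simp at this
    omega

lemma card_cell (N j D : ℕ) (κ c : ℝ) (hκ : κ ≠ 0) (hD : 1 / |κ| ≤ D) :
    ((Finset.range N).filter (fun Q : ℕ => ⌊|κ * (Q + c)|⌋₊ = j)).card ≤ 2 * (D + 1) := by
  have hκ' : 0 < |κ| := abs_pos.2 hκ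
  set S := (Finset.range N).filter (fun Q : ℕ => ⌊|κ * (Q + c)|⌋₊ = j) with hS
  have hb : ∀ Q ∈ S, (j : ℝ) ≤ |κ| * |(Q : ℝ) + c| ∧ |κ| * |(Q : ℝ) + c| < j + 1 := by
    intro Q hQ
    have := (Finset.mem_filter.1 hQ).2
    rw [← abs_mul, ← this]
    exact ⟨Nat.floor_le (abs_nonneg _), Nat.lt_floor_add_one _⟩
  have hdiff : ∀ Q ∈ S, ∀ Q' ∈ S, |(Q : ℝ) + c| ≤ |(Q' : ℝ) + c| + D := by
    intro Q hQ Q' hQ'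
    have h1 := (hb Q hQ).2
    have h2 := (hb Q' hQ').1
    have : |κ| * |(Q : ℝ) + c| ≤ |κ| * (|(Q' : ℝ) + c| + D) := by
      have : 1 ≤ |κ| * D := by rwa [div_le_iff₀ hκ', mul_comm] at hD
      nlinarith
    exact le_of_mul_le_mul_left this hκ'
  rw [← Finset.card_filter_add_card_filter_not (s := S) (fun Q : ℕ => 0 ≤ (Q : ℝ) + c), two_mul]
  refine add_le_add (card_le_of_diam _ _ ?_) (card_le_of_diam _ _ ?_)
  · intro Q hQ Q' hQ'
    rw [Finset.mem_filter] at hQ hQ'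
    have := hdiff Q hQ.1 Q' hQ'.1
    rw [abs_of_nonneg hQ.2, abs_of_nonneg hQ'.2] at this
    have : (Q : ℝ) ≤ Q' + D := by linarith
    exact_mod_cast this
  · intro Q hQ Q' hQ'
    rw [Finset.mem_filter, not_le] at hQ hQ'
    have := hdiff Q' hQ'.1 Q hQ.1
    rw [abs_of_neg hQ.2, abs_of_neg hQ'.2] at this
    have : (Q : ℝ) ≤ Q' + D := by linarith
    exact_mod_cast this

lemma sum_cells (N N' D : ℕ) (κ c : ℝ) (hκ : κ ≠ 0) (hD : 1 / |κ| ≤ D) (W : ℕ → ℝ)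
    (hW : ∀ j, 0 ≤ W j) (hN : ∀ Q < N, ⌊|κ * (Q + c)|⌋₊ < N') :
    ∑ Q ∈ Finset.range N, W ⌊|κ * (Q + c)|⌋₊ ≤ (2 * (D + 1) : ℕ) * ∑ j ∈ Finset.range N', W j := by
  rw [← Finset.sum_fiberwise_of_maps_to (s := Finset.range N) (t := Finset.range N')
    (g := fun Q : ℕ => ⌊|κ * (Q + c)|⌋₊) (fun Q hQ => by
      rw [Finset.mem_range] at hQ ⊢; exact hN Q hQ), Finset.mul_sum]
  refine Finset.sum_le_sum fun j _ => ?_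
  rw [Finset.sum_congr rfl (g := fun _ => W j) (fun Q hQ => by rw [(Finset.mem_filter.1 hQ).2]),
    Finset.sum_const, nsmul_eq_mul]
  have := card_cell N j D κ c hκ hD
  have h2 : (((Finset.range N).filter (fun Q : ℕ => ⌊|κ * (Q + c)|⌋₊ = j)).card : ℝ) ≤ (2 * (D + 1) : ℕ) := by
    exact_mod_cast this
  exact mul_le_mul_of_nonneg_right h2 (hW j)

lemma avg_slope {b m : ℕ} (hb : 2 ≤ b) (hm : 0 < m) (hmb : m ≤ b) (s y : ℝ) (hs : s ≠ 0) (k0 D : ℕ)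
    (hk0 : |s| * (1 + |y|) ≤ (b : ℝ) ^ k0) (hD : 1 / |s| ≤ D) (k r : ℕ) (l : ℝ)
    (hl0 : (b : ℝ) ^ k ≤ l) (hl1 : l < (b : ℝ) ^ (k + 1)) :
    ∑ Q ∈ PP b m (k + r), ‖psi b m (k + 1 + k0) ((Q / (b : ℝ) ^ (k + r) - y) * s * l)‖ ≤
      (m : ℝ) ^ r * ((2 * (D + 1) : ℕ) * GG b m ^ (k + 1 + k0)) := by
  have hb0 : 0 < b := by omega
  have hbr : (0 : ℝ) < b := by exact_mod_cast hb0
  have hbk : (0 : ℝ) < (b : ℝ) ^ k := by positivity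
  have hbr' : (0 : ℝ) < (b : ℝ) ^ r := by positivity
  have hl : 0 < l := lt_of_lt_of_le hbk hl0
  rw [sum_PP_add hmb, Finset.sum_comm]
  have hc : (m : ℝ) ^ r * ((2 * (D + 1) : ℕ) * GG b m ^ (k + 1 + k0)) =
      ∑ R ∈ PP b m r, ((2 * (D + 1) : ℕ) * GG b m ^ (k + 1 + k0)) := by
    rw [Finset.sum_const, card_PP hmb, nsmul_eq_mul]; push_cast; rfl
  rw [hc]
  refine Finset.sum_le_sum fun R hR => ?_
  set κ : ℝ := s * l / (b : ℝ) ^ k with hκ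
  set τ : ℝ := R / (b : ℝ) ^ r with hτ
  have hτ0 : 0 ≤ τ := by positivity
  have hτ1 : τ < 1 := by
    rw [hτ, div_lt_one hbr']; exact_mod_cast PP_lt hmb r R hR
  set c : ℝ := τ - y * (b : ℝ) ^ k with hc
  have harg : ∀ Q : ℕ, (((Q * b ^ r + R : ℕ) : ℝ) / (b : ℝ) ^ (k + r) - y) * s * l = κ * (Q + c) := by
    intro Q
    rw [hκ, hc, hτ]; push_cast; rw [pow_add]; field_simp; ring
  have hκs : |s| ≤ |κ| := by
    rw [hκ, abs_div, abs_mul, abs_of_pos hl, abs_of_pos hbk, le_div_iff₀ hbk]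
    exact mul_le_mul_of_nonneg_left hl0 (abs_nonneg _)
  have hs' : 0 < |s| := abs_pos.2 hs
  have hκ0 : κ ≠ 0 := abs_pos.1 (lt_of_lt_of_le hs' hκs)
  calc _ ≤ ∑ Q ∈ PP b m k, WW b m (k + 1 + k0) ⌊|κ * (Q + c)|⌋₊ := by
        refine Finset.sum_le_sum fun Q _ => ?_
        rw [harg]
        exact norm_psi_le_WW hb0 hm hmb _ _
    _ ≤ ∑ Q ∈ Finset.range (b ^ k), WW b m (k + 1 + k0) ⌊|κ * (Q + c)|⌋₊ :=
        sum_PP_le hmb k (fun Q => WW b m (k + 1 + k0) ⌊|κ * (Q + c)|⌋₊) (fun Q => WW_nonneg hb0 _ _)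
    _ ≤ (2 * (D + 1) : ℕ) * ∑ j ∈ Finset.range (b ^ (k + 1 + k0)), WW b m (k + 1 + k0) j := by
        refine sum_cells _ _ D κ c hκ0 ?_ _ (WW_nonneg hb0 _) ?_
        · exact (one_div_le_one_div_of_le hs' hκs).trans hD
        · intro Q hQ
          rw [Nat.floor_lt (abs_nonneg _)]
          have hQ' : (Q : ℝ) + 1 ≤ (b : ℝ) ^ k := by exact_mod_cast hQ
          have h1 : |(Q : ℝ) + c| ≤ (b : ℝ) ^ k * (1 + |y|) := by
            rw [hc, ← add_sub_assoc]
            refine (abs_sub _ _).trans ?_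
            rw [abs_of_nonneg (by positivity), abs_mul, abs_of_pos hbk]
            nlinarith
          have h2 : |κ| * (b : ℝ) ^ k = |s| * l := by
            rw [hκ, abs_div, abs_mul, abs_of_pos hl, abs_of_pos hbk]; field_simp
          rw [abs_mul]
          push_cast
          calc |κ| * |(Q : ℝ) + c| ≤ |κ| * ((b : ℝ) ^ k * (1 + |y|)) := by gcongr
            _ = (|s| * (1 + |y|)) * l := by rw [← mul_assoc, h2]; ring
            _ ≤ (b : ℝ) ^ k0 * l := by gcongr
            _ < (b : ℝ) ^ k0 * (b : ℝ) ^ (k + 1) := by gcongr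
            _ = (b : ℝ) ^ (k + 1 + k0) := by ring
    _ = _ := by rw [sum_WW hb0]

lemma integral_psi_le {b m : ℕ} (hb : 2 ≤ b) (hm : 0 < m) (hmb : m ≤ b) (k : ℕ) :
    ∫ l in (0:ℝ)..((b : ℝ) ^ k), ‖psi b m k l‖ ≤ GG b m ^ k := by
  have hb0 : 0 < b := by omega
  have hi : ∀ u v : ℝ, IntervalIntegrable (fun l => ‖psi b m k l‖) volume u v :=
    fun u v => (continuous_psi b m k).norm.intervalIntegrable u v
  have := intervalIntegral.sum_integral_adjacent_intervals (f := fun l => ‖psi b m k l‖)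
    (μ := volume) (a := fun j : ℕ => (j : ℝ)) (n := b ^ k) (fun j _ => hi _ _)
  push_cast at this
  rw [← this, ← sum_WW hb0]
  refine Finset.sum_le_sum fun j _ => ?_
  have h1 : ∫ l in (j : ℝ)..(j + 1), ‖psi b m k l‖ ≤ ∫ l in (j : ℝ)..(j + 1), WW b m k j := by
    refine intervalIntegral.integral_mono_on_of_le_Ioo (by linarith) (hi _ _) (by simp) ?_
    intro l hl
    have hj : (0 : ℝ) ≤ j := by positivity
    have : ⌊|l|⌋₊ = j := by
      rw [abs_of_nonneg (hj.trans hl.1.le)]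
      exact (Nat.floor_eq_iff (hj.trans hl.1.le)).2 ⟨hl.1.le, hl.2⟩
    rw [← this]
    exact norm_psi_le_WW hb0 hm hmb k l
  simpa using h1

/-- shell integrals -/
def AA (b m k0 : ℕ) (s y : ℝ) (k : ℕ) (q : ℝ) : ℝ :=
  ∫ l in ((b : ℝ) ^ k)..((b : ℝ) ^ (k + 1)), ‖psi b m (k + 1) l‖ * ‖psi b m (k + 1 + k0) ((q - y) * s * l)‖

lemma continuous_AA (b m k0 : ℕ) (s y : ℝ) (k : ℕ) : Continuous (AA b m k0 s y k) := by
  unfold AA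
  apply intervalIntegral.continuous_parametric_intervalIntegral_of_continuous'
  fun_prop

lemma AA_nonneg {b m k0 : ℕ} (hb : 2 ≤ b) (s y : ℝ) (k : ℕ) (q : ℝ) : 0 ≤ AA b m k0 s y k q := by
  refine intervalIntegral.integral_nonneg ?_ fun _ _ => by positivity
  have : (1 : ℝ) ≤ b := by exact_mod_cast (by omega : 1 ≤ b)
  exact pow_le_pow_right₀ this (by omega)

lemma avg_AA {b m : ℕ} (hb : 2 ≤ b) (hm : 0 < m) (hmb : m ≤ b) (s y : ℝ) (hs : s ≠ 0) (k0 D : ℕ)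
    (hk0 : |s| * (1 + |y|) ≤ (b : ℝ) ^ k0) (hD : 1 / |s| ≤ D) (k n : ℕ) (hkn : k ≤ n) :
    ∑ Q ∈ PP b m n, AA b m k0 s y k (Q / (b : ℝ) ^ n) ≤
      (m : ℝ) ^ n * (((2 * (D + 1) : ℕ) * GG b m ^ (k0 + 2)) * (GG b m ^ 2 / m) ^ k) := by
  obtain ⟨r, rfl⟩ := Nat.exists_eq_add_of_le hkn
  have hm' : (0 : ℝ) < m := by exact_mod_cast hm
  have hb1 : (1 : ℝ) ≤ b := by exact_mod_cast (by omega : 1 ≤ b)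
  have hle : (b : ℝ) ^ k ≤ (b : ℝ) ^ (k + 1) := pow_le_pow_right₀ hb1 (by omega)
  unfold AA
  set c : ℝ := (m : ℝ) ^ r * ((2 * (D + 1) : ℕ) * GG b m ^ (k + 1 + k0)) with hc
  have hc0 : 0 ≤ c := by have := GG_nonneg b m; positivity
  rw [← intervalIntegral.integral_finsetSum (fun Q _ => Continuous.intervalIntegrable (by fun_prop) _ _)]
  calc _ ≤ ∫ l in ((b : ℝ) ^ k)..((b : ℝ) ^ (k + 1)), ‖psi b m (k + 1) l‖ * c := by
        refine intervalIntegral.integral_mono_on_of_le_Ioo hle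
          (Continuous.intervalIntegrable (by fun_prop) _ _)
          (Continuous.intervalIntegrable (by fun_prop) _ _) ?_
        intro l hl
        rw [← Finset.mul_sum]
        exact mul_le_mul_of_nonneg_left (avg_slope hb hm hmb s y hs k0 D hk0 hD k r l hl.1.le hl.2)
          (norm_nonneg _)
    _ = (∫ l in ((b : ℝ) ^ k)..((b : ℝ) ^ (k + 1)), ‖psi b m (k + 1) l‖) * c := by
        rw [intervalIntegral.integral_mul_const]
    _ ≤ GG b m ^ (k + 1) * c := by
        refine mul_le_mul_of_nonneg_right ?_ hc0
        refine le_trans ?_ (integral_psi_le hb hm hmb (k + 1))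
        refine intervalIntegral.integral_mono_interval (by positivity) hle le_rfl 
          (Filter.Eventually.of_forall fun _ => norm_nonneg _)
          (Continuous.intervalIntegrable (by fun_prop) _ _)
    _ = _ := by
        rw [hc, div_pow, pow_add (m : ℝ) k r]
        field_simp
        ring

lemma exists_slope {b m : ℕ} (hb : 2 ≤ b) (hm : 0 < m) (hmb : m ≤ b) (hG : GG b m ^ 2 < m)
    (s y : ℝ) (hs : s ≠ 0) :
    ∃ (q : ℝ) (M : ℝ) (k0 : ℕ), (∀ ε > 0, ∀ N : ℕ, ∃ n ≥ N, ∃ Q ∈ PP b m n, |Q / (b : ℝ) ^ n - q| < ε) ∧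
      ∀ K : ℕ, ∑ k ∈ Finset.range K, AA b m k0 s y k q ≤ M := by
  have hb1 : (1 : ℝ) < b := by exact_mod_cast hb
  have hm' : (0 : ℝ) < m := by exact_mod_cast hm
  obtain ⟨k0, hk0⟩ := pow_unbounded_of_one_lt (|s| * (1 + |y|)) hb1
  obtain ⟨D, hD⟩ := exists_nat_ge (1 / |s|)
  set C : ℝ := (2 * (D + 1) : ℕ) * GG b m ^ (k0 + 2) with hC
  set ρ : ℝ := GG b m ^ 2 / m with hρ
  have hGn := GG_nonneg b m
  have hC0 : 0 ≤ C := by positivity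
  have hρ0 : 0 ≤ ρ := by positivity
  have hρ1 : ρ < 1 := by rw [hρ, div_lt_one hm']; exact hG
  set M : ℝ := C * (1 - ρ)⁻¹ with hM
  have hex : ∀ n : ℕ, ∃ Q ∈ PP b m n, ∑ k ∈ Finset.range n, AA b m k0 s y k (Q / (b : ℝ) ^ n) ≤ M := by
    intro n
    refine Finset.exists_le_of_sum_le (s := PP b m n) (g := fun _ => M) ⟨0, zero_mem_PP hm n⟩ ?_
    rw [Finset.sum_comm, Finset.sum_const, card_PP hmb, nsmul_eq_mul]
    push_cast
    calc _ ≤ ∑ k ∈ Finset.range n, (m : ℝ) ^ n * (C * ρ ^ k) :=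
          Finset.sum_le_sum fun k hk => avg_AA hb hm hmb s y hs k0 D hk0.le hD k n (Finset.mem_range.1 hk).le
      _ = (m : ℝ) ^ n * (C * ∑ k ∈ Finset.range n, ρ ^ k) := by rw [Finset.mul_sum, Finset.mul_sum]
      _ ≤ (m : ℝ) ^ n * M := by
          rw [hM]
          gcongr
          rw [← tsum_geometric_of_lt_one hρ0 hρ1]
          exact (summable_geometric_of_lt_one hρ0 hρ1).sum_le_tsum _ (fun _ _ => by positivity)
  choose Q hQ hQM using hex
  have hmem : ∀ n, (Q n : ℝ) / (b : ℝ) ^ n ∈ Set.Icc (0 : ℝ) 1 := fun n =>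
    (PP_mem_MDset hb hm hmb n (Q n) (hQ n)).1
  obtain ⟨q, _, φ, hφ, hlim⟩ := isCompact_Icc.tendsto_subseq hmem
  refine ⟨q, M, k0, ?_, ?_⟩
  · intro ε hε N
    have h1 := (Metric.tendsto_atTop.1 hlim) ε hε
    obtain ⟨N1, hN1⟩ := h1
    refine ⟨φ (max N N1), (le_max_left _ _).trans (hφ.id_le _), Q _, hQ _, ?_⟩
    exact hN1 _ (le_max_right _ _)
  · intro K
    have hc : Continuous (fun q => ∑ k ∈ Finset.range K, AA b m k0 s y k q) :=
      continuous_finsetSum _ fun k _ => continuous_AA b m k0 s y k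
    refine le_of_tendsto ((hc.tendsto q).comp hlim) ?_
    filter_upwards [Filter.eventually_ge_atTop K] with n hn
    refine le_trans ?_ (hQM (φ n))
    refine Finset.sum_le_sum_of_subset_of_nonneg ?_ (fun k _ _ => AA_nonneg hb s y k _)
    intro k hk
    rw [Finset.mem_range] at hk ⊢
    have := hφ.id_le n
    simp only [id] at this
    omega

lemma measurable_Psi {b m : ℕ} {Psi : ℝ → ℂ}
    (hP : ∀ l, Tendsto (fun n => psi b m n l) atTop (𝓝 (Psi l))) : Measurable Psi :=
  measurable_of_tendsto_metrizable (fun n => (continuous_psi b m n).measurable)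
    (tendsto_pi_nhds.2 hP)

lemma norm_Psi_le {b m : ℕ} (hb : 0 < b) (hmb : m ≤ b) {Psi : ℝ → ℂ}
    (hP : ∀ l, Tendsto (fun n => psi b m n l) atTop (𝓝 (Psi l))) (k : ℕ) (l : ℝ) :
    ‖Psi l‖ ≤ ‖psi b m k l‖ := by
  refine le_of_tendsto (hP l).norm ?_
  filter_upwards [Filter.eventually_ge_atTop k] with n hn
  exact norm_psi_anti hb hmb hn l

lemma norm_Psi_neg {b m : ℕ} (hb : 0 < b) (hmb : m ≤ b) {Psi : ℝ → ℂ}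
    (hP : ∀ l, Tendsto (fun n => psi b m n l) atTop (𝓝 (Psi l))) (l : ℝ) :
    ‖Psi (-l)‖ = ‖Psi l‖ := by
  refine tendsto_nhds_unique (hP (-l)).norm ?_
  refine (hP l).norm.congr fun n => ?_
  rw [psi_eq_prod hb hmb, psi_eq_prod hb hmb, norm_prod, norm_prod]
  refine Finset.prod_congr rfl fun i _ => ?_
  rw [neg_div, norm_DD_neg]

lemma integrable_of_AA {b m : ℕ} (hb : 2 ≤ b) (hmb : m ≤ b) {Psi : ℝ → ℂ}
    (hP : ∀ l, Tendsto (fun n => psi b m n l) atTop (𝓝 (Psi l))) (s y q M : ℝ) (k0 : ℕ)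
    (hM : ∀ K : ℕ, ∑ k ∈ Finset.range K, AA b m k0 s y k q ≤ M) :
    Integrable (fun l => Psi l * Psi (((q - y) * s) * l)) := by
  have hb0 : 0 < b := by omega
  have hb1 : (1 : ℝ) < b := by exact_mod_cast hb
  set θ := (q - y) * s with hθ
  set f : ℝ → ℂ := fun l => Psi l * Psi (θ * l) with hf
  have hmeas : Measurable f := (measurable_Psi hP).mul ((measurable_Psi hP).comp (measurable_const_mul θ))
  have hP1 : ∀ l, ‖Psi l‖ ≤ 1 := fun l =>
    (norm_Psi_le hb0 hmb hP 0 l).trans (norm_psi_le_one hb0 hmb _ _)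
  have hf1 : ∀ l, ‖f l‖ ≤ 1 := fun l => by
    rw [hf]; simp only [norm_mul]
    exact mul_le_one₀ (hP1 _) (norm_nonneg _) (hP1 _)
  have hii : ∀ u v : ℝ, IntervalIntegrable f volume u v := fun u v => by
    refine (intervalIntegrable_const (c := (1:ℝ))).mono_fun hmeas.aestronglyMeasurable ?_
    filter_upwards with l
    simpa using hf1 l
  have heven : ∀ l, ‖f (-l)‖ = ‖f l‖ := fun l => by
    simp only [hf, norm_mul, mul_neg, norm_Psi_neg hb0 hmb hP]
  refine integrable_of_intervalIntegral_norm_bounded (2 * (1 + M)) (a := fun K : ℕ => -(b : ℝ) ^ K)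
    (b := fun K : ℕ => (b : ℝ) ^ K) (l := atTop) ?_ ?_ ?_ ?_
  · intro K
    have := hii (-(b : ℝ) ^ K) ((b : ℝ) ^ K)
    exact this.1
  · exact tendsto_neg_atTop_atBot.comp (tendsto_pow_atTop_atTop_of_one_lt hb1)
  · exact tendsto_pow_atTop_atTop_of_one_lt hb1
  · filter_upwards with K
    have hin : ∀ u v : ℝ, IntervalIntegrable (fun l => ‖f l‖) volume u v := fun u v => (hii u v).norm
    have e1 : ∫ l in (-(b : ℝ) ^ K)..0, ‖f l‖ = ∫ l in (0:ℝ)..((b : ℝ) ^ K), ‖f l‖ := by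
      have := intervalIntegral.integral_comp_neg (a := 0) (b := (b : ℝ) ^ K) (fun l => ‖f l‖)
      simp only [heven, neg_zero] at this
      rw [this]
    have e2 : ∫ l in (0:ℝ)..1, ‖f l‖ ≤ 1 := by
      have := intervalIntegral.integral_mono_on (a := 0) (b := 1) (μ := volume) zero_le_one (hin 0 1)
        (intervalIntegrable_const (c := (1:ℝ))) (fun l _ => hf1 l)
      simpa using this
    have e3 : ∫ l in (1:ℝ)..((b : ℝ) ^ K), ‖f l‖ ≤ M := by
      have := intervalIntegral.sum_integral_adjacent_intervals (f := fun l => ‖f l‖)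
        (μ := volume) (a := fun j : ℕ => (b : ℝ) ^ j) (n := K) (fun j _ => hin _ _)
      rw [pow_zero] at this
      rw [← this]
      refine le_trans (Finset.sum_le_sum fun k _ => ?_) (hM K)
      refine intervalIntegral.integral_mono_on (pow_le_pow_right₀ hb1.le (by omega)) (hin _ _)
        (Continuous.intervalIntegrable (by fun_prop) _ _) ?_
      intro l _
      simp only [hf, norm_mul]
      exact mul_le_mul (norm_Psi_le hb0 hmb hP _ _) (norm_Psi_le hb0 hmb hP _ _) (norm_nonneg _) (norm_nonneg _)
    rw [← intervalIntegral.integral_add_adjacent_intervals (hin _ 0) (hin _ _), e1,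
      ← intervalIntegral.integral_add_adjacent_intervals (hin 0 1) (hin _ _)]
    linarith
/-! ### The density -/

open scoped FourierTransform ContDiff in
lemma test_fun (φ : ℝ → ℝ) (hφ : ContDiff ℝ ∞ φ) (hc : HasCompactSupport φ) :
    ∃ h : ℝ → ℂ, Integrable h ∧ (∀ t, ∫ l, ee (l * t) * h l = (φ t : ℂ)) ∧
      ∀ Φ : ℝ → ℂ, Integrable Φ →
        ∫ t, (∫ l, ee (-(t * l)) * Φ l) * (φ t : ℂ) = ∫ l, Φ l * h l := by
  have hc' : HasCompactSupport (fun t => (φ t : ℂ)) := hc.comp_left (g := fun x : ℝ => (x : ℂ)) (by simp)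
  have hφ' : ContDiff ℝ ∞ (fun t => (φ t : ℂ)) := Complex.ofRealCLM.contDiff.comp hφ
  set f : SchwartzMap ℝ ℂ := hc'.toSchwartzMap hφ' with hf
  have hfe : (f : ℝ → ℂ) = fun t => (φ t : ℂ) := rfl
  have hfi : Integrable (fun t => (φ t : ℂ)) := by rw [← hfe]; exact f.integrable
  have hki : Integrable (𝓕 (fun t => (φ t : ℂ))) := by
    rw [← hfe, ← SchwartzMap.fourier_coe]; exact SchwartzMap.integrable _
  refine ⟨𝓕 (fun t => (φ t : ℂ)), hki, ?_, ?_⟩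
  · intro t
    have := congrFun (Continuous.fourierInv_fourier_eq hφ'.continuous hfi hki) t
    rw [← this, Real.fourierInv_eq']
    refine integral_congr_ae (Eventually.of_forall fun l => ?_)
    simp only [ee, smul_eq_mul]
    congr 4
    simp [mul_comm]
  · intro Φ hΦ
    have := VectorFourier.integral_fourierIntegral_smul_eq_flip (e := 𝐞) (μ := volume) (ν := volume)
      (L := innerₗ ℝ) (f := Φ) (g := fun t : ℝ => (φ t : ℂ)) Real.continuous_fourierChar
      (by exact continuous_inner) hΦ hfi
    have h1 : ∀ t, ∫ l, ee (-(t * l)) * Φ l = VectorFourier.fourierIntegral 𝐞 volume (innerₗ ℝ) Φ t := by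
      intro t
      rw [show VectorFourier.fourierIntegral 𝐞 volume (innerₗ ℝ) Φ t = 𝓕 Φ t from rfl,
        Real.fourier_real_eq_integral_exp_smul]
      refine integral_congr_ae (Eventually.of_forall fun l => ?_)
      simp only [ee, smul_eq_mul]
      congr 4
      ring
    simp_rw [h1]
    rw [show (innerₗ ℝ : ℝ →ₗ[ℝ] ℝ →ₗ[ℝ] ℝ).flip = innerₗ ℝ from by ext; simp] at this
    exact this

/-- the density -/
def rho (Φ : ℝ → ℂ) (t : ℝ) : ℝ := (∫ l, ee (-(t * l)) * Φ l).re

lemma continuous_rhoC (Φ : ℝ → ℂ) (hΦ : Integrable Φ) : Continuous fun t : ℝ => ∫ l, ee (-(t * l)) * Φ l := by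
  refine continuous_of_dominated (bound := fun l => ‖Φ l‖) ?_ ?_ hΦ.norm ?_
  · intro t
    exact (Continuous.aestronglyMeasurable (by fun_prop)).mul hΦ.1
  · intro t
    filter_upwards with l
    rw [norm_mul, norm_ee, one_mul]
  · filter_upwards with l
    fun_prop

lemma continuous_rho (Φ : ℝ → ℂ) (hΦ : Integrable Φ) : Continuous (rho Φ) :=
  Complex.continuous_re.comp (continuous_rhoC Φ hΦ)

open scoped ContDiff in
lemma rho_test {b m : ℕ} (hb : 0 < b) (hmb : m ≤ b) {Psi : ℝ → ℂ}
    (hP : ∀ l, Tendsto (fun n => psi b m n l) atTop (𝓝 (Psi l))) (θ : ℝ)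
    (hΦ : Integrable (fun l => Psi l * Psi (θ * l))) (φ : ℝ → ℝ) (hφ : ContDiff ℝ ∞ φ)
    (hc : HasCompactSupport φ) :
    Tendsto (fun n => (1 / (m : ℝ) ^ n) ^ 2 * ∑ J ∈ PP b m n, ∑ K ∈ PP b m n, φ ((J + θ * K) / (b : ℝ) ^ n))
      atTop (𝓝 (∫ t, rho (fun l => Psi l * Psi (θ * l)) t * φ t)) := by
  obtain ⟨h, hi, h1, h2⟩ := test_fun φ hφ hc
  have e1 : ∫ t, rho (fun l => Psi l * Psi (θ * l)) t * φ t = (∫ l, Psi l * Psi (θ * l) * h l).re := by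
    rw [← h2 _ hΦ]
    have hint : Integrable (fun t : ℝ => (∫ l, ee (-(t * l)) * (Psi l * Psi (θ * l))) * (φ t : ℂ)) := by
      refine Continuous.integrable_of_hasCompactSupport ?_ ?_
      · exact (continuous_rhoC _ hΦ).mul (Complex.continuous_ofReal.comp hφ.continuous)
      · exact (hc.comp_left (g := fun x : ℝ => (x : ℂ)) (by simp)).mul_left
    have := integral_re hint
    simp only [RCLike.re_eq_complex_re] at this
    rw [← this]
    refine integral_congr_ae (Eventually.of_forall fun t => ?_)
    simp [rho]
  rw [e1]
  have key : Tendsto (fun n => ∫ l, psi b m n l * psi b m n (θ * l) * h l) atTop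
      (𝓝 (∫ l, Psi l * Psi (θ * l) * h l)) := by
    refine tendsto_integral_of_dominated_convergence (fun l => ‖h l‖) ?_ hi.norm ?_ ?_
    · intro n
      exact (Continuous.aestronglyMeasurable (by fun_prop)).mul hi.1
    · intro n
      filter_upwards with l
      rw [norm_mul, norm_mul]
      exact mul_le_of_le_one_left (norm_nonneg _) (mul_le_one₀ (norm_psi_le_one hb hmb _ _)
        (norm_nonneg _) (norm_psi_le_one hb hmb _ _))
    · filter_upwards with l
      exact ((hP l).mul (hP (θ * l))).mul_const _
  have key2 := (Complex.continuous_re.tendsto _).comp key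
  refine key2.congr fun n => ?_
  simp only [Function.comp]
  have e2 : ∀ l, psi b m n l * psi b m n (θ * l) * h l = ∑ J ∈ PP b m n, ∑ K ∈ PP b m n,
      ((1 / m ^ n : ℂ) ^ 2 * (ee (l * ((J + θ * K) / (b : ℝ) ^ n)) * h l)) := by
    intro l
    rw [psi, psi, mul_mul_mul_comm, Finset.sum_mul_sum, Finset.mul_sum, Finset.sum_mul]
    refine Finset.sum_congr rfl fun J _ => ?_
    rw [Finset.mul_sum, Finset.sum_mul]
    refine Finset.sum_congr rfl fun K _ => ?_
    rw [← ee_add]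
    have : l * (J / (b : ℝ) ^ n) + θ * l * (K / (b : ℝ) ^ n) = l * ((J + θ * K) / (b : ℝ) ^ n) := by ring
    rw [this]; ring
  have hint : ∀ J K : ℕ, Integrable (fun l => (1 / m ^ n : ℂ) ^ 2 * (ee (l * ((J + θ * K) / (b : ℝ) ^ n)) * h l)) := by
    intro J K
    refine Integrable.const_mul ?_ _
    refine hi.bdd_mul (c := 1) (Continuous.aestronglyMeasurable (by fun_prop)) ?_
    filter_upwards with l
    rw [norm_ee]
  simp_rw [e2]
  rw [integral_finsetSum _ (fun J _ => integrable_finsetSum _ fun K _ => hint J K)]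
  simp_rw [integral_finsetSum _ (fun K _ => hint _ K), integral_const_mul, h1]
  rw [Finset.mul_sum]
  simp_rw [Finset.mul_sum]
  rw [Complex.re_sum]
  refine Finset.sum_congr rfl fun J _ => ?_
  rw [Complex.re_sum]
  refine Finset.sum_congr rfl fun K _ => ?_
  have : (1 / m ^ n : ℂ) ^ 2 * (φ ((J + θ * K) / (b : ℝ) ^ n) : ℂ) =
    (((1 / m ^ n : ℝ) ^ 2 * φ ((J + θ * K) / (b : ℝ) ^ n) : ℝ) : ℂ) := by push_cast; ring
  rw [this, Complex.ofReal_re]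
lemma abs_comb_le {b m : ℕ} (hb : 0 < b) (hmb : m ≤ b) (θ : ℝ) (n J K : ℕ) (hJ : J ∈ PP b m n)
    (hK : K ∈ PP b m n) : |(J + θ * K) / (b : ℝ) ^ n| ≤ 1 + |θ| := by
  have hB : (0 : ℝ) < (b : ℝ) ^ n := by positivity
  have h1 : (J : ℝ) ≤ (b : ℝ) ^ n := by exact_mod_cast (PP_lt hmb n J hJ).le
  have h2 : (K : ℝ) ≤ (b : ℝ) ^ n := by exact_mod_cast (PP_lt hmb n K hK).le
  rw [abs_div, abs_of_pos hB, div_le_iff₀ hB]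
  refine (abs_add_le _ _).trans ?_
  rw [abs_mul, Nat.abs_cast, Nat.abs_cast]
  nlinarith [abs_nonneg θ]

lemma rho_nonneg {b m : ℕ} (hb : 0 < b) (hmb : m ≤ b) {Psi : ℝ → ℂ}
    (hP : ∀ l, Tendsto (fun n => psi b m n l) atTop (𝓝 (Psi l))) (θ : ℝ)
    (hΦ : Integrable (fun l => Psi l * Psi (θ * l))) (t : ℝ) :
    0 ≤ rho (fun l => Psi l * Psi (θ * l)) t := by
  by_contra! hneg
  set ρ := rho (fun l => Psi l * Psi (θ * l)) with hρ
  have hcont : Continuous ρ := continuous_rho _ hΦ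
  obtain ⟨ε, hε, hball⟩ := Metric.isOpen_iff.1 (isOpen_lt hcont continuous_const) t hneg
  let φ : ContDiffBump t := ⟨ε / 2, ε, by positivity, by linarith⟩
  have hlim := rho_test hb hmb hP θ hΦ φ φ.contDiff φ.hasCompactSupport
  have h0 : 0 ≤ ∫ x, ρ x * φ x := by
    refine ge_of_tendsto' hlim fun n => ?_
    refine mul_nonneg (by positivity) (Finset.sum_nonneg fun J _ => Finset.sum_nonneg fun K _ => φ.nonneg)
  have h1 : 0 < ∫ x, -(ρ x * φ x) := by
    refine Continuous.integral_pos_of_hasCompactSupport_nonneg_nonzero (x := t) ?_ ?_ ?_ ?_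
    · exact (hcont.mul φ.continuous).neg
    · exact (φ.hasCompactSupport.mul_left (f := ρ)).comp_left (g := fun x : ℝ => -x) (by simp)
    · intro x
      simp only [Pi.zero_apply]
      by_cases hx : x ∈ ball t ε
      · have : ρ x < 0 := hball hx
        have := φ.nonneg (x := x)
        nlinarith
      · have : φ x = 0 := φ.zero_of_le_dist (by simpa using hx)
        simp [this]
    · have : φ t = 1 := φ.one_of_mem_closedBall (by simp [φ.rIn_pos.le])
      simp only [this]
      intro h; linarith
  rw [integral_neg] at h1
  linarith

lemma rho_support {b m : ℕ} (hb : 0 < b) (hmb : m ≤ b) {Psi : ℝ → ℂ}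
    (hP : ∀ l, Tendsto (fun n => psi b m n l) atTop (𝓝 (Psi l))) (θ : ℝ)
    (hΦ : Integrable (fun l => Psi l * Psi (θ * l))) (t : ℝ) (ht : 1 + |θ| < |t|) :
    rho (fun l => Psi l * Psi (θ * l)) t = 0 := by
  by_contra hne
  set ρ := rho (fun l => Psi l * Psi (θ * l)) with hρ
  have hcont : Continuous ρ := continuous_rho _ hΦ
  let φ : ContDiffBump t := ⟨(|t| - (1 + |θ|)) / 2, |t| - (1 + |θ|), by linarith, by linarith⟩
  have hlim := rho_test hb hmb hP θ hΦ φ φ.contDiff φ.hasCompactSupport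
  have h0 : ∫ x, ρ x * φ x = 0 := by
    refine tendsto_nhds_unique hlim ?_
    refine tendsto_const_nhds.congr fun n => ?_
    rw [eq_comm]
    refine mul_eq_zero_of_right _ (Finset.sum_eq_zero fun J hJ => Finset.sum_eq_zero fun K hK => ?_)
    refine φ.zero_of_le_dist ?_
    have := abs_comb_le hb hmb θ n J K hJ hK
    change |t| - (1 + |θ|) ≤ _
    rw [Real.dist_eq, abs_sub_comm]
    have := abs_sub_abs_le_abs_sub t ((J + θ * K) / (b : ℝ) ^ n)
    linarith
  have h1 : 0 < ∫ x, ρ x * φ x := by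
    refine Continuous.integral_pos_of_hasCompactSupport_nonneg_nonzero (x := t) ?_ ?_ ?_ ?_
    · exact hcont.mul φ.continuous
    · exact φ.hasCompactSupport.mul_left
    · intro x
      exact mul_nonneg (rho_nonneg hb hmb hP θ hΦ x) φ.nonneg
    · have : φ t = 1 := φ.one_of_mem_closedBall (by simp [φ.rIn_pos.le])
      simp only [this]
      simpa using hne
  linarith

lemma rho_integral {b m : ℕ} (hb : 0 < b) (hm : 0 < m) (hmb : m ≤ b) {Psi : ℝ → ℂ}
    (hP : ∀ l, Tendsto (fun n => psi b m n l) atTop (𝓝 (Psi l))) (θ : ℝ)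
    (hΦ : Integrable (fun l => Psi l * Psi (θ * l))) :
    ∫ t, rho (fun l => Psi l * Psi (θ * l)) t = 1 := by
  have hθ := abs_nonneg θ
  let φ : ContDiffBump (0 : ℝ) := ⟨1 + |θ|, 1 + |θ| + 1, by linarith, by linarith⟩
  have hlim := rho_test hb hmb hP θ hΦ φ φ.contDiff φ.hasCompactSupport
  have e : ∀ x, rho (fun l => Psi l * Psi (θ * l)) x * φ x = rho (fun l => Psi l * Psi (θ * l)) x := by
    intro x
    by_cases hx : |x| ≤ 1 + |θ|
    · rw [φ.one_of_mem_closedBall (by simpa using hx), mul_one]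
    · rw [rho_support hb hmb hP θ hΦ x (by simpa using hx), zero_mul]
  simp_rw [e] at hlim
  refine tendsto_nhds_unique hlim ?_
  refine tendsto_const_nhds.congr fun n => ?_
  have : ∀ J ∈ PP b m n, ∑ K ∈ PP b m n, φ ((J + θ * K) / (b : ℝ) ^ n) = (m : ℝ) ^ n := by
    intro J hJ
    rw [Finset.sum_congr rfl (g := fun _ => (1 : ℝ))]
    · simp [card_PP hmb]
    · intro K hK
      refine φ.one_of_mem_closedBall ?_
      rw [mem_closedBall, dist_zero_right, Real.norm_eq_abs]
      exact abs_comb_le hb hmb θ n J K hJ hK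
  rw [Finset.sum_congr rfl this, Finset.sum_const, card_PP hmb, nsmul_eq_mul]
  have : (m : ℝ) ≠ 0 := by positivity
  push_cast
  field_simp

lemma rho_funeq {b m : ℕ} (hb : 0 < b) (hmb : m ≤ b) {Psi : ℝ → ℂ}
    (hP : ∀ l, Tendsto (fun n => psi b m n l) atTop (𝓝 (Psi l))) (θ : ℝ)
    (hΦ : Integrable (fun l => Psi l * Psi (θ * l))) (r : ℕ) (t : ℝ) :
    rho (fun l => Psi l * Psi (θ * l)) t = (b : ℝ) ^ r * (1 / (m : ℝ) ^ r) ^ 2 *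
      ∑ J ∈ PP b m r, ∑ K ∈ PP b m r,
        rho (fun l => Psi l * Psi (θ * l)) ((b : ℝ) ^ r * t - J - θ * K) := by
  have hB : (0 : ℝ) < (b : ℝ) ^ r := by positivity
  have hPsi : ∀ l, Psi l = psi b m r l * Psi (l / (b : ℝ) ^ r) := by
    intro l
    have h1 : Tendsto (fun n => psi b m (r + n) l) atTop (𝓝 (Psi l)) :=
      (hP l).comp (tendsto_add_atTop_nat r |>.congr fun n => by ring)
    refine tendsto_nhds_unique h1 ?_
    simp_rw [psi_add hb hmb]
    exact (hP _).const_mul _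
  set Φ : ℝ → ℂ := fun l => Psi l * Psi (θ * l) with hΦd
  set f : ℕ → ℕ → ℝ → ℂ := fun J K l => (1 / m ^ r : ℂ) ^ 2 *
    (ee (-(((b : ℝ) ^ r * t - J - θ * K) * l)) * Φ l) with hf
  have e2 : ∀ l, ee (-(t * l)) * Φ l = (fun u => ∑ J ∈ PP b m r, ∑ K ∈ PP b m r, f J K u) (l / (b : ℝ) ^ r) := by
    intro l
    simp only [hΦd, hf]
    rw [hPsi l, hPsi (θ * l), psi, psi]
    have hre : ∀ c A P B Q e : ℂ, e * (c * A * P * (c * B * Q)) = c ^ 2 * (e * (P * Q)) * (A * B) := by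
      intros; ring
    rw [hre, Finset.sum_mul_sum, Finset.mul_sum]
    refine Finset.sum_congr rfl fun J _ => ?_
    rw [Finset.mul_sum]
    refine Finset.sum_congr rfl fun K _ => ?_
    have h3 : -(((b : ℝ) ^ r * t - J - θ * K) * (l / (b : ℝ) ^ r)) =
      -(t * l) + (l * (J / (b : ℝ) ^ r) + θ * l * (K / (b : ℝ) ^ r)) := by field_simp; ring
    rw [h3, ee_add, ee_add, mul_div_assoc]; ring
  have hint : ∀ J K : ℕ, Integrable (f J K) := by
    intro J K
    refine Integrable.const_mul ?_ _
    refine hΦ.bdd_mul (c := 1) (Continuous.aestronglyMeasurable (by fun_prop)) ?_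
    filter_upwards with l
    rw [norm_ee]
  rw [rho]
  rw [integral_congr_ae (Eventually.of_forall e2)]
  rw [Measure.integral_comp_div (fun u => ∑ J ∈ PP b m r, ∑ K ∈ PP b m r, f J K u) ((b : ℝ) ^ r), abs_of_pos hB,
    integral_finsetSum _ (fun J _ => integrable_finsetSum _ fun K _ => hint J K)]
  simp_rw [integral_finsetSum _ (fun K _ => hint _ K), hf, integral_const_mul]
  rw [Complex.smul_re, smul_eq_mul, mul_assoc, Complex.re_sum, Finset.mul_sum (a := (1 / (m : ℝ) ^ r) ^ 2)]
  congr 1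
  refine Finset.sum_congr rfl fun J _ => ?_
  rw [Complex.re_sum, Finset.mul_sum]
  refine Finset.sum_congr rfl fun K _ => ?_
  rw [show ((1 : ℂ) / m ^ r) ^ 2 = (((1 / m ^ r : ℝ) ^ 2 : ℝ) : ℂ) by push_cast; ring, Complex.re_ofReal_mul]
  rfl
lemma cover {b m : ℕ} (hb : 2 ≤ b) (ρ : ℝ → ℝ) (hcont : Continuous ρ) (hnn : ∀ t, 0 ≤ ρ t)
    (C θ : ℝ) (hC : 1 ≤ C) (hsupp : ∀ t, C ≤ |t| → ρ t = 0) (hint : ∫ t, ρ t = 1)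
    (hfe : ∀ (r : ℕ) (t : ℝ), ρ t = (b : ℝ) ^ r * (1 / (m : ℝ) ^ r) ^ 2 *
      ∑ J ∈ PP b m r, ∑ K ∈ PP b m r, ρ ((b : ℝ) ^ r * t - J - θ * K)) :
    ∃ κ > 0, ∃ δ > 0, ∃ r : ℕ, 1 ≤ r ∧ (∀ u v : ℝ, |u - v| ≤ δ → |ρ u - ρ v| ≤ κ) ∧
      (∀ t, κ ≤ ρ t → ∃ J ∈ PP b m r, ∃ K ∈ PP b m r, 2 * κ ≤ ρ ((b : ℝ) ^ r * t - J - θ * K)) ∧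
      ∃ t, κ < ρ t := by
  have hb1 : (1 : ℝ) < b := by exact_mod_cast hb
  have hC0 : 0 < C := by linarith
  set κ : ℝ := 1 / (16 * C) with hκ
  have hκ0 : 0 < κ := by positivity
  have hκC : 16 * C * κ = 1 := by rw [hκ]; field_simp
  have hcs : HasCompactSupport ρ := by
    refine HasCompactSupport.intro (isCompact_Icc (a := -C) (b := C)) fun x hx => hsupp x ?_
    by_contra! h
    exact hx ⟨(abs_lt.1 h).1.le, (abs_lt.1 h).2.le⟩
  have hI1 : ∀ a c : ℝ, a ≤ -C → C ≤ c → ∫ x in a..c, ρ x = 1 := by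
    intro a c ha hc
    rw [intervalIntegral.integral_eq_integral_of_support_subset, hint]
    intro x hx
    have : |x| < C := by
      by_contra! h
      exact hx (hsupp x h)
    rw [abs_lt] at this
    exact ⟨by linarith, by linarith⟩
  have huc := hcs.uniformContinuous_of_continuous hcont
  obtain ⟨δ, hδ, hδ'⟩ := Metric.uniformContinuous_iff.1 huc κ hκ0
  obtain ⟨r, hr⟩ := pow_unbounded_of_one_lt (4 * C / δ) hb1
  set r' := r + 1 with hr'
  set B : ℝ := (b : ℝ) ^ r' with hB
  have hB0 : 0 < B := by positivity
  have hBr : 4 * C / δ < B := hr.trans_le (pow_le_pow_right₀ hb1.le (by omega))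
  have hosc : ∀ u v : ℝ, |u - v| ≤ δ / 2 → |ρ u - ρ v| ≤ κ := by
    intro u v huv
    have := hδ' (a := u) (b := v) (by rw [Real.dist_eq]; linarith)
    rw [Real.dist_eq] at this
    exact this.le
  have hBδ : 2 * C / B ≤ δ / 2 := by
    rw [div_lt_iff₀ hδ] at hBr
    rw [div_le_iff₀ hB0]; linarith
  refine ⟨κ, hκ0, δ / 2, by positivity, r', by omega, hosc, ?_, ?_⟩
  · intro t ht
    by_contra! hcon
    set c : ℝ := B * (1 / (m : ℝ) ^ r') ^ 2 with hc
    have hc0 : 0 ≤ c := by positivity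
    have hfe' : ∀ u, ρ u = c * ∑ p ∈ PP b m r' ×ˢ PP b m r', ρ (B * u - (p.1 + θ * p.2)) := by
      intro u
      rw [hfe r' u, Finset.sum_product]
      simp only [sub_sub]
      rfl
    set S := (PP b m r' ×ˢ PP b m r').filter (fun p => |B * t - ((p.1 : ℝ) + θ * p.2)| < C) with hS
    have h1 : ρ t = c * ∑ p ∈ S, ρ (B * t - (p.1 + θ * p.2)) := by
      rw [hfe' t]
      congr 1
      rw [hS, Finset.sum_filter_of_ne]
      intro p _ hp
      by_contra! h
      exact hp (hsupp _ h)
    have h2 : c * ∑ p ∈ S, ρ (B * t - (p.1 + θ * p.2)) ≤ c * (S.card * (2 * κ)) := by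
      refine mul_le_mul_of_nonneg_left ?_ hc0
      rw [← nsmul_eq_mul]
      refine Finset.sum_le_card_nsmul _ _ _ fun p hp => ?_
      rw [hS, Finset.mem_filter, Finset.mem_product] at hp
      have := hcon p.1 hp.1.1 p.2 hp.1.2
      rw [sub_sub] at this
      exact this.le
    have h2' : c * ∑ p ∈ S, ρ (B * t - (p.1 + θ * p.2)) < c * (S.card * (2 * κ)) := by
      have hne : c * ∑ p ∈ S, ρ (B * t - (p.1 + θ * p.2)) ≠ 0 := by rw [← h1]; linarith
      have hcp : 0 < c := lt_of_le_of_ne hc0 (fun h => hne (by rw [← h, zero_mul]))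
      refine mul_lt_mul_of_pos_left ?_ hcp
      rw [← nsmul_eq_mul, ← Finset.sum_const]
      refine Finset.sum_lt_sum_of_nonempty ?_ fun p hp => ?_
      · rw [Finset.nonempty_iff_ne_empty]
        intro h
        rw [h] at hne; simp at hne
      rw [hS, Finset.mem_filter, Finset.mem_product] at hp
      have := hcon p.1 hp.1.1 p.2 hp.1.2
      rw [sub_sub] at this
      exact this
    -- integral bounds
    have hle : t - 2 * C / B ≤ t + 2 * C / B := by
      have : 0 ≤ 2 * C / B := by positivity
      linarith
    have h3 : ∫ u in (t - 2 * C / B)..(t + 2 * C / B), ρ u ≤ (4 * C / B) * (ρ t + κ) := by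
      have := intervalIntegral.integral_mono_on hle (hcont.intervalIntegrable (μ := volume) _ _)
        (intervalIntegrable_const (c := ρ t + κ)) (fun u hu => ?_)
      · refine this.trans (le_of_eq ?_)
        rw [intervalIntegral.integral_const, smul_eq_mul]; ring
      · have : |u - t| ≤ δ / 2 := by
          rw [abs_le]; constructor <;> linarith [hu.1, hu.2]
        linarith [(abs_le.1 (hosc u t this)).2]
    have h4 : c * S.card / B ≤ ∫ u in (t - 2 * C / B)..(t + 2 * C / B), ρ u := by
      have e : ∀ p : ℕ × ℕ, ∫ u in (t - 2 * C / B)..(t + 2 * C / B), ρ (B * u - (p.1 + θ * p.2)) =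
          B⁻¹ * ∫ u in (B * t - (p.1 + θ * p.2) - 2 * C)..(B * t - (p.1 + θ * p.2) + 2 * C), ρ u := by
        intro p
        rw [intervalIntegral.integral_comp_mul_sub _ hB0.ne', smul_eq_mul]
        have e1 : B * (t - 2 * C / B) - ((p.1 : ℝ) + θ * p.2) = B * t - (p.1 + θ * p.2) - 2 * C := by
          field_simp; ring
        have e2 : B * (t + 2 * C / B) - ((p.1 : ℝ) + θ * p.2) = B * t - (p.1 + θ * p.2) + 2 * C := by
          field_simp; ring
        rw [e1, e2]
      rw [intervalIntegral.integral_congr (g := fun u => c * ∑ p ∈ PP b m r' ×ˢ PP b m r', ρ (B * u - (p.1 + θ * p.2)))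
        (fun u _ => hfe' u), intervalIntegral.integral_const_mul, intervalIntegral.integral_finsetSum]
      · rw [mul_div_assoc]
        refine mul_le_mul_of_nonneg_left ?_ hc0
        calc (S.card : ℝ) / B = ∑ p ∈ S, B⁻¹ := by rw [Finset.sum_const, nsmul_eq_mul]; rfl
          _ ≤ ∑ p ∈ S, ∫ u in (t - 2 * C / B)..(t + 2 * C / B), ρ (B * u - (p.1 + θ * p.2)) := by
            refine Finset.sum_le_sum fun p hp => ?_
            rw [hS, Finset.mem_filter, abs_lt] at hp
            rw [e, hI1, mul_one] <;> linarith [hp.2.1, hp.2.2]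
          _ ≤ _ := by
            refine Finset.sum_le_sum_of_subset_of_nonneg (Finset.filter_subset _ _) fun p _ _ => ?_
            exact intervalIntegral.integral_nonneg hle fun u _ => hnn _
      · intro p _
        exact (hcont.comp (by fun_prop)).intervalIntegrable _ _
    have h5 : c * S.card ≤ 8 * C * ρ t := by
      have := h4.trans h3
      rw [div_le_iff₀ hB0] at this
      have e : 4 * C / B * (ρ t + κ) * B = 4 * C * (ρ t + κ) := by field_simp
      rw [e] at this
      nlinarith
    have h6 : ρ t < 8 * C * ρ t * (2 * κ) := by
      calc ρ t < c * (S.card * (2 * κ)) := by rw [h1]; exact h2'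
        _ = (c * S.card) * (2 * κ) := by ring
        _ ≤ _ := by gcongr
    have : 8 * C * ρ t * (2 * κ) = ρ t := by linear_combination ρ t * hκC
    linarith
  · by_contra! h
    have h1 := hI1 (-C) C le_rfl le_rfl
    have h2 := intervalIntegral.integral_mono_on (by linarith : -C ≤ C) (hcont.intervalIntegrable (μ := volume) _ _)
        (intervalIntegrable_const (c := κ)) (fun u _ => h u)
    rw [h1, intervalIntegral.integral_const, smul_eq_mul] at h2
    nlinarith

lemma exists_rho {b m : ℕ} (hb : 2 ≤ b) (hm : 0 < m) (hmb : m ≤ b) {Psi : ℝ → ℂ}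
    (hP : ∀ l, Tendsto (fun n => psi b m n l) atTop (𝓝 (Psi l))) (θ : ℝ)
    (hΦ : Integrable (fun l => Psi l * Psi (θ * l))) :
    ∃ ρ : ℝ → ℝ, ∃ κ > 0, ∃ δ > 0, ∃ r : ℕ, 1 ≤ r ∧ Continuous ρ ∧ (∀ t, 2 + |θ| ≤ |t| → ρ t = 0) ∧
      (∀ u v : ℝ, |u - v| ≤ δ → |ρ u - ρ v| ≤ κ) ∧
      (∀ t, κ ≤ ρ t → ∃ J ∈ PP b m r, ∃ K ∈ PP b m r, 2 * κ ≤ ρ ((b : ℝ) ^ r * t - J - θ * K)) ∧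
      ∃ t, κ < ρ t := by
  have hb0 : 0 < b := by omega
  have h0 := abs_nonneg θ
  have hs : ∀ t, 2 + |θ| ≤ |t| → rho (fun l => Psi l * Psi (θ * l)) t = 0 :=
    fun t ht => rho_support hb0 hmb hP θ hΦ t (by linarith)
  obtain ⟨κ, hκ, δ, hδ, r, hr, h1, h2, h3⟩ := cover hb (rho fun l => Psi l * Psi (θ * l)) (continuous_rho _ hΦ)
    (rho_nonneg hb0 hmb hP θ hΦ) (2 + |θ|) θ (by linarith) hs (rho_integral hb0 hm hmb hP θ hΦ)
    (rho_funeq hb0 hmb hP θ hΦ)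
  exact ⟨_, κ, hκ, δ, hδ, r, hr, continuous_rho _ hΦ, hs, h1, h2, h3⟩
/-! ### Nonlinear iteration -/

/-- squared distance -/
def ff (x₁ x₂ y₁ y₂ : ℝ) : ℝ := (y₁ - x₁) ^ 2 + (y₂ - x₂) ^ 2

lemma step_bound (x₁ x₂ p q η δ A B t u v J K θ : ℝ) (hp : p ≠ x₁) (hθ : θ = (q - x₂) / (p - x₁))
    (hA : 0 < A) (hB : 0 < B) (hAη : A⁻¹ ≤ η) (hu : |u - p| ≤ η) (hv : |v - q| ≤ η)
    (hJ0 : 0 ≤ J) (hJ : J ≤ B) (hK0 : 0 ≤ K) (hK : K ≤ B) (hη : η * (3 * B) ≤ δ * |p - x₁|) :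
    |(B * (A * (t - ff x₁ x₂ u v) / (2 * (p - x₁))) - J - θ * K) -
      (A * B) * (t - ff x₁ x₂ (u + J / (A * B)) (v + K / (A * B))) / (2 * (p - x₁))| ≤ δ := by
  have hd : p - x₁ ≠ 0 := sub_ne_zero.2 hp
  have hd0 : 0 < |p - x₁| := abs_pos.2 hd
  have e : (B * (A * (t - ff x₁ x₂ u v) / (2 * (p - x₁))) - J - θ * K) -
      (A * B) * (t - ff x₁ x₂ (u + J / (A * B)) (v + K / (A * B))) / (2 * (p - x₁)) =
      ((u - p) * J + (v - q) * K + A⁻¹ * (J * (J / B) + K * (K / B)) / 2) / (p - x₁) := by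
    rw [hθ]; unfold ff; field_simp; ring
  rw [e, abs_div, div_le_iff₀ hd0]
  refine le_trans ?_ hη
  have hη0 : 0 ≤ η := (abs_nonneg _).trans hu
  have h1 : |(u - p) * J| ≤ η * B := by
    rw [abs_mul, abs_of_nonneg hJ0]; gcongr
  have h2 : |(v - q) * K| ≤ η * B := by
    rw [abs_mul, abs_of_nonneg hK0]; gcongr
  have hJB : J / B ≤ 1 := by rw [div_le_one hB]; exact hJ
  have hKB : K / B ≤ 1 := by rw [div_le_one hB]; exact hK
  have hJB0 : 0 ≤ J / B := by positivity
  have hKB0 : 0 ≤ K / B := by positivity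
  have h3 : |A⁻¹ * (J * (J / B) + K * (K / B)) / 2| ≤ η * B := by
    have h4 : 0 ≤ J * (J / B) + K * (K / B) := by positivity
    have h5 : J * (J / B) + K * (K / B) ≤ 2 * B := by nlinarith
    rw [abs_of_nonneg (by positivity)]
    have : A⁻¹ * (J * (J / B) + K * (K / B)) ≤ η * (2 * B) := by gcongr
    linarith
  have := abs_add_le ((u - p) * J + (v - q) * K) (A⁻¹ * (J * (J / B) + K * (K / B)) / 2)
  have := abs_add_le ((u - p) * J) ((v - q) * K)
  linarith

lemma iterate_interval {b m : ℕ} (hb : 2 ≤ b) (hm : 0 < m) (hmb : m ≤ b) (x₁ x₂ p q θ : ℝ) (hp : p ≠ x₁)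
    (hθ : θ = (q - x₂) / (p - x₁)) (hpp : ∀ N : ℕ, 1 ≤ N → ∃ P ∈ PP b m N, (P : ℝ) / (b : ℝ) ^ N = p)
    (hq : ∀ ε > 0, ∀ N : ℕ, ∃ n ≥ N, ∃ Q ∈ PP b m n, |(Q : ℝ) / (b : ℝ) ^ n - q| < ε)
    (ρ : ℝ → ℝ) (κ : ℝ) (hκ : 0 < κ) (δ : ℝ) (hδ : 0 < δ) (r : ℕ) (hr : 1 ≤ r) (hcont : Continuous ρ)
    (hsupp : ∀ t, 2 + |θ| ≤ |t| → ρ t = 0) (hosc : ∀ u v : ℝ, |u - v| ≤ δ → |ρ u - ρ v| ≤ κ)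
    (hcov : ∀ t, κ ≤ ρ t → ∃ J ∈ PP b m r, ∃ K ∈ PP b m r, 2 * κ ≤ ρ ((b : ℝ) ^ r * t - J - θ * K))
    (hex : ∃ t, κ < ρ t) :
    ∃ u v : ℝ, u < v ∧ ∀ t ∈ Ioo u v, ∃ y₁ ∈ MDset b m, ∃ y₂ ∈ MDset b m, ff x₁ x₂ y₁ y₂ = t := by
  have hb1 : (1 : ℝ) < b := by exact_mod_cast hb
  have hb0 : (0 : ℝ) < b := by linarith
  have hd : p - x₁ ≠ 0 := sub_ne_zero.2 hp
  have hd0 : 0 < |p - x₁| := abs_pos.2 hd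
  set B : ℝ := (b : ℝ) ^ r with hB
  have hB0 : 0 < B := by positivity
  set η : ℝ := δ * |p - x₁| / (3 * B) with hηd
  have hη0 : 0 < η := by positivity
  have hη : η * (3 * B) ≤ δ * |p - x₁| := by rw [hηd]; field_simp; rfl
  have hinv1 : (b : ℝ)⁻¹ < 1 := inv_lt_one_of_one_lt₀ hb1
  have hinv0 : 0 ≤ (b : ℝ)⁻¹ := by positivity
  obtain ⟨N0, hN0⟩ := exists_pow_lt_of_lt_one (half_pos hη0) hinv1
  obtain ⟨N, hN, Q0, hQ0, hQ0'⟩ := hq (η / 2) (half_pos hη0) (N0 + 1)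
  obtain ⟨P0, hP0, hP0'⟩ := hpp N (by omega)
  have hNη : ((b : ℝ) ^ N)⁻¹ ≤ η / 2 := by
    rw [← inv_pow]
    exact (pow_le_pow_of_le_one hinv0 hinv1.le (by omega)).trans hN0.le
  set q0 : ℝ := (Q0 : ℝ) / (b : ℝ) ^ N with hq0
  have main : ∀ t, κ ≤ ρ ((b : ℝ) ^ N * (t - ff x₁ x₂ p q0) / (2 * (p - x₁))) →
      ∀ i : ℕ, ∃ P ∈ PP b m (N + r * i), ∃ Q ∈ PP b m (N + r * i), ∃ y z : ℝ,
        y = (P : ℝ) / (b : ℝ) ^ (N + r * i) ∧ z = (Q : ℝ) / (b : ℝ) ^ (N + r * i) ∧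
        p ≤ y ∧ y ≤ p + ((b : ℝ) ^ N)⁻¹ - ((b : ℝ) ^ (N + r * i))⁻¹ ∧
        q0 ≤ z ∧ z ≤ q0 + ((b : ℝ) ^ N)⁻¹ - ((b : ℝ) ^ (N + r * i))⁻¹ ∧
        κ ≤ ρ ((b : ℝ) ^ (N + r * i) * (t - ff x₁ x₂ y z) / (2 * (p - x₁))) := by
    intro t ht i
    induction i with
    | zero =>
      refine ⟨P0, hP0, Q0, hQ0, p, q0, hP0'.symm, rfl, le_rfl, by simp, le_rfl, by simp, ?_⟩
      simpa using ht
    | succ i ih =>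
      obtain ⟨P, hPm, Q, hQm, y, z, hy, hz, y1, y2, z1, z2, hk⟩ := ih
      set n := N + r * i with hn
      set A : ℝ := (b : ℝ) ^ n with hA
      have hA0 : 0 < A := by positivity
      have hAi : 0 < A⁻¹ := by positivity
      have hAN : A⁻¹ ≤ ((b : ℝ) ^ N)⁻¹ := by
        rw [hA, ← inv_pow, ← inv_pow]
        exact pow_le_pow_of_le_one hinv0 hinv1.le (by omega)
      obtain ⟨J, hJ, K, hK, hJK⟩ := hcov _ hk
      have hnr : N + r * (i + 1) = n + r := by rw [hn]; ring
      have hJ1 : (J : ℝ) + 1 ≤ B := by rw [hB]; exact_mod_cast PP_lt hmb r J hJ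
      have hK1 : (K : ℝ) + 1 ≤ B := by rw [hB]; exact_mod_cast PP_lt hmb r K hK
      have hJ0 : (0 : ℝ) ≤ J := by positivity
      have hK0 : (0 : ℝ) ≤ K := by positivity
      rw [hnr]
      have hpow : (b : ℝ) ^ (n + r) = A * B := pow_add _ _ _
      have hstep : ∀ R : ℕ, (R : ℝ) + 1 ≤ B → (R : ℝ) / (A * B) ≤ A⁻¹ - (A * B)⁻¹ := by
        intro R hR
        rw [div_le_iff₀ (by positivity)]
        have : (A⁻¹ - (A * B)⁻¹) * (A * B) = B - 1 := by field_simp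
        linarith
      refine ⟨P * b ^ r + J, mem_PP_add hPm hJ, Q * b ^ r + K, mem_PP_add hQm hK,
        y + J / (A * B), z + K / (A * B), ?_, ?_, ?_, ?_, ?_, ?_, ?_⟩
      · rw [hpow, hy]; push_cast; rw [← hB]; field_simp
      · rw [hpow, hz]; push_cast; rw [← hB]; field_simp
      · have : 0 ≤ (J : ℝ) / (A * B) := by positivity
        linarith
      · rw [hpow]; linarith [hstep J hJ1]
      · have : 0 ≤ (K : ℝ) / (A * B) := by positivity
        linarith
      · rw [hpow]; linarith [hstep K hK1]
      · rw [hpow]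
        have hb' := step_bound x₁ x₂ p q η δ A B t y z J K θ hp hθ hA0 hB0 (by linarith)
          (by rw [abs_le]; constructor <;> linarith)
          (by rw [abs_lt] at hQ0'; rw [abs_le]; constructor <;> linarith [hQ0'.1, hQ0'.2])
          hJ0 (by linarith) hK0 (by linarith) hη
        have := (abs_le.1 (hosc _ _ hb')).2
        linarith
  -- closedness
  have hcl : IsClosed ((fun z : ℝ × ℝ => ff x₁ x₂ z.1 z.2) '' (MDset b m ×ˢ MDset b m)) := by
    refine (((isCompact_MDset hb hmb).prod (isCompact_MDset hb hmb)).image ?_).isClosed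
    unfold ff; fun_prop
  have main2 : ∀ t, κ ≤ ρ ((b : ℝ) ^ N * (t - ff x₁ x₂ p q0) / (2 * (p - x₁))) →
      ∃ y₁ ∈ MDset b m, ∃ y₂ ∈ MDset b m, ff x₁ x₂ y₁ y₂ = t := by
    intro t ht
    have : t ∈ (fun z : ℝ × ℝ => ff x₁ x₂ z.1 z.2) '' (MDset b m ×ˢ MDset b m) := by
      rw [← hcl.closure_eq, Metric.mem_closure_iff]
      intro ε hε
      set C : ℝ := (2 + |θ|) * |2 * (p - x₁)| with hCd
      have hC0 : 0 < C := by
        have : 0 < |2 * (p - x₁)| := abs_pos.2 (by simpa using hd)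
        positivity
      obtain ⟨i, hi⟩ := exists_pow_lt_of_lt_one (div_pos hε hC0) hinv1
      obtain ⟨P, hPm, Q, hQm, y, z, hy, hz, -, -, -, -, hk⟩ := main t ht i
      refine ⟨ff x₁ x₂ y z, ⟨(y, z), ⟨?_, ?_⟩, rfl⟩, ?_⟩
      · rw [hy]; exact PP_mem_MDset hb hm hmb _ _ hPm
      · rw [hz]; exact PP_mem_MDset hb hm hmb _ _ hQm
      · rw [Real.dist_eq]
        set n := N + r * i with hn
        have hT : |(b : ℝ) ^ n * (t - ff x₁ x₂ y z) / (2 * (p - x₁))| < 2 + |θ| := by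
          by_contra! h
          have := hsupp _ h
          linarith
        have h2 : 0 < |2 * (p - x₁)| := abs_pos.2 (by simpa using hd)
        rw [abs_div, div_lt_iff₀ h2, abs_mul, abs_of_pos (by positivity : (0 : ℝ) < (b : ℝ) ^ n), ← hCd] at hT
        have h3 : ((b : ℝ) ^ n)⁻¹ < ε / C := by
          rw [← inv_pow]
          refine lt_of_le_of_lt (pow_le_pow_of_le_one hinv0 hinv1.le ?_) hi
          rw [hn]; nlinarith
        have hbn : (0 : ℝ) < (b : ℝ) ^ n := by positivity
        calc |t - ff x₁ x₂ y z| = ((b : ℝ) ^ n)⁻¹ * ((b : ℝ) ^ n * |t - ff x₁ x₂ y z|) := by field_simp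
          _ ≤ ((b : ℝ) ^ n)⁻¹ * C := by gcongr
          _ < ε / C * C := by gcongr
          _ = ε := by field_simp
    obtain ⟨⟨y, z⟩, ⟨h1, h2⟩, h3⟩ := this
    exact ⟨y, h1, z, h2, h3⟩
  obtain ⟨τ, hτ⟩ := hex
  have hopen : IsOpen {t : ℝ | κ < ρ ((b : ℝ) ^ N * (t - ff x₁ x₂ p q0) / (2 * (p - x₁)))} :=
    isOpen_lt continuous_const (hcont.comp (by fun_prop))
  have hmem : ff x₁ x₂ p q0 + 2 * (p - x₁) * τ / (b : ℝ) ^ N ∈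
      {t : ℝ | κ < ρ ((b : ℝ) ^ N * (t - ff x₁ x₂ p q0) / (2 * (p - x₁)))} := by
    have : (b : ℝ) ^ N * (ff x₁ x₂ p q0 + 2 * (p - x₁) * τ / (b : ℝ) ^ N - ff x₁ x₂ p q0) / (2 * (p - x₁)) = τ := by
      rw [add_sub_cancel_left]; field_simp
    simp only [mem_ofPred_eq, this]; exact hτ
  obtain ⟨ε, hε, hsub⟩ := Metric.isOpen_iff.1 hopen _ hmem
  rw [Real.ball_eq_Ioo] at hsub
  exact ⟨_, _, by linarith, fun t ht => main2 t (le_of_lt (hsub ht))⟩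

lemma exists_interval_sq {b m : ℕ} (hb : 2 ≤ b) (hm : 2 ≤ m) (hmb : m ≤ b) (hG : GG b m ^ 2 < m) (x₁ x₂ : ℝ) :
    ∃ u v : ℝ, u < v ∧ ∀ t ∈ Ioo u v, ∃ y₁ ∈ MDset b m, ∃ y₂ ∈ MDset b m, ff x₁ x₂ y₁ y₂ = t := by
  have hb0 : (0 : ℝ) < b := by positivity
  have hm0 : 0 < m := by omega
  obtain ⟨p, hp, hpp⟩ : ∃ p : ℝ, p ≠ x₁ ∧ ∀ N : ℕ, 1 ≤ N → ∃ P ∈ PP b m N, (P : ℝ) / (b : ℝ) ^ N = p := by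
    by_cases h : (0 : ℝ) = x₁
    · refine ⟨1 / b, ?_, ?_⟩
      · rw [← h]; positivity
      · intro N hN
        obtain ⟨k, rfl⟩ := Nat.exists_eq_add_of_le hN
        have h1 : 1 ∈ PP b m 1 := by
          have := mem_PP_succ (n := 0) (zero_mem_PP (b := b) hm0 0) (show 1 < m by omega)
          simpa using this
        refine ⟨_, mem_PP_add h1 (zero_mem_PP hm0 k), ?_⟩
        push_cast
        rw [pow_add]; field_simp; ring
    · exact ⟨0, h, fun N _ => ⟨0, zero_mem_PP hm0 N, by simp⟩⟩
  have hd : p - x₁ ≠ 0 := sub_ne_zero.2 hp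
  obtain ⟨q, M, k0, hq, hM⟩ := exists_slope hb hm0 hmb hG (1 / (p - x₁)) x₂ (by simpa using hd)
  obtain ⟨Psi, hP⟩ := exists_Psi hb hm0 hmb
  have hΦ := integrable_of_AA hb hmb hP _ _ q M k0 hM
  obtain ⟨ρ, κ, hκ, δ, hδ, r, hr, h1, h2, h3, h4, h5⟩ := exists_rho hb hm0 hmb hP _ hΦ
  exact iterate_interval hb hm0 hmb x₁ x₂ p q _ hp (by ring) hpp hq ρ κ hκ δ hδ r hr h1 h2 h3 h4 h5
/-! ### Conclusion -/

lemma final_general {b m : ℕ} (hb : 2 ≤ b) (hm : 2 ≤ m) (hmb : m ≤ b) (hG : GG b m ^ 2 < m)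
    (x : EuclideanSpace ℝ (Fin 2)) :
    ∃ u v : ℝ, u < v ∧ Set.Ioo u v ⊆
      {r : ℝ | ∃ y ∈ {v : EuclideanSpace ℝ (Fin 2) | v 0 ∈ MDset b m ∧ v 1 ∈ MDset b m}, dist x y = r} := by
  obtain ⟨u, v, huv, h⟩ := exists_interval_sq hb hm hmb hG (x 0) (x 1)
  have hu : 0 ≤ u := by
    by_contra! hneg
    obtain ⟨t, h1, h2⟩ := exists_between (lt_min huv hneg)
    obtain ⟨y, _, z, _, he⟩ := h t ⟨h1, h2.trans_le (min_le_left _ _)⟩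
    have : 0 ≤ ff (x 0) (x 1) y z := by unfold ff; positivity
    have := h2.trans_le (min_le_right _ _)
    linarith
  refine ⟨√u, √v, Real.sqrt_lt_sqrt hu huv, ?_⟩
  intro r hr
  have hr0 : 0 ≤ r := (Real.sqrt_nonneg u).trans hr.1.le
  have h1 : u < r ^ 2 := (Real.sqrt_lt' (lt_of_le_of_lt (Real.sqrt_nonneg u) hr.1)).1 hr.1
  have h2 : r ^ 2 < v := (Real.lt_sqrt hr0).1 hr.2
  obtain ⟨y, hy, z, hz, he⟩ := h (r ^ 2) ⟨h1, h2⟩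
  refine ⟨!₂[y, z], ⟨by simpa using hy, by simpa using hz⟩, ?_⟩
  rw [EuclideanSpace.dist_eq, Fin.sum_univ_two, Real.dist_eq, Real.dist_eq, sq_abs, sq_abs]
  have : (x 0 - (!₂[y, z] : EuclideanSpace ℝ (Fin 2)) 0) ^ 2 + (x 1 - (!₂[y, z] : EuclideanSpace ℝ (Fin 2)) 1) ^ 2 = r ^ 2 := by
    rw [← he, ff]; simp; ring
  rw [this, Real.sqrt_sq hr0]

lemma num_aux (z L G : ℝ) (h1 : 1 ≤ z) (h2 : L ≤ 90000) (h3 : G ≤ 2 + z * (1 + L)) :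
    G ≤ z * (10 : ℝ) ^ 6 := by
  nlinarith

lemma GG_num (b m : ℕ) (hb : b = 10 ^ 9000) (hm : m = 10 ^ 7000) : GG b m ^ 2 < m := by
  have hb2 : 2 ≤ b := by
    rw [hb]
    calc 2 ≤ 10 ^ 1 := by norm_num
      _ ≤ 10 ^ 9000 := Nat.pow_le_pow_right (by norm_num) (by norm_num)
  have hbr : (b : ℝ) = (10 : ℝ) ^ 2000 * (10 : ℝ) ^ 7000 := by
    rw [hb, ← pow_add, Nat.cast_pow, Nat.cast_ofNat]
  have hmr : (m : ℝ) = (10 : ℝ) ^ 7000 := by rw [hm, Nat.cast_pow, Nat.cast_ofNat]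
  have hlog : Real.log b ≤ 90000 := by
    rw [hb, Nat.cast_pow, Nat.cast_ofNat, Real.log_pow]
    have := Real.log_le_sub_one_of_pos (show (0 : ℝ) < 10 by norm_num)
    rw [Nat.cast_ofNat]
    linarith
  have hdiv : (b : ℝ) / m = (10 : ℝ) ^ 2000 := by
    rw [hbr, hmr, mul_div_assoc, div_self (pow_ne_zero _ (by norm_num)), mul_one]
  have hG := GG_le (m := m) hb2
  rw [hdiv] at hG
  have h1 : (1 : ℝ) ≤ (10 : ℝ) ^ 2000 := one_le_pow₀ (by norm_num)
  have hG2 : GG b m ≤ (10 : ℝ) ^ 2000 * (10 : ℝ) ^ 6 := by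
    exact num_aux _ _ _ h1 hlog hG
  rw [← pow_add] at hG2
  calc GG b m ^ 2 ≤ ((10 : ℝ) ^ (2000 + 6)) ^ 2 := pow_le_pow_left₀ (GG_nonneg b m) hG2 2
    _ = (10 : ℝ) ^ ((2000 + 6) * 2) := (pow_mul _ _ _).symm
    _ < (10 : ℝ) ^ 7000 := pow_lt_pow_right₀ (by norm_num) (by norm_num)
    _ = m := hmr.symm

lemma final_num (b m : ℕ) (hb : b = 10 ^ 9000) (hm : m = 10 ^ 7000) (x : EuclideanSpace ℝ (Fin 2)) :
    ∃ u v : ℝ, u < v ∧ Set.Ioo u v ⊆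
      {r : ℝ | ∃ y ∈ {v : EuclideanSpace ℝ (Fin 2) | v 0 ∈ MDset b m ∧ v 1 ∈ MDset b m}, dist x y = r} := by
  have hm2 : 2 ≤ m := by
    rw [hm]
    calc 2 ≤ 10 ^ 1 := by norm_num
      _ ≤ 10 ^ 7000 := Nat.pow_le_pow_right (by norm_num) (by norm_num)
  have hmb : m ≤ b := by
    rw [hm, hb]; exact Nat.pow_le_pow_right (by norm_num) (by norm_num)
  exact final_general (hm2.trans hmb) hm2 hmb (GG_num b m hb hm) x

/-- with `K₂` the set of numbers in `[0,1]` whose base-`10^9000` expansions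
use only the digits `0,…,10^7000 - 1`, and `K = K₂ × K₂ ⊆ [0,1]²`, for every `x ∈ ℝ²` the
pinned distance set `Δ_x(K) = {|x - y| : y ∈ K}` contains a nonempty open interval; in
particular it has positive Lebesgue measure. -/
theorem statement15 (K : Set (EuclideanSpace ℝ (Fin 2)))
    (hK : K = {v | v 0 ∈ MDset (10 ^ 9000) (10 ^ 7000) ∧ v 1 ∈ MDset (10 ^ 9000) (10 ^ 7000)})
    (x : EuclideanSpace ℝ (Fin 2)) :
    (∃ a b : ℝ, a < b ∧ Set.Ioo a b ⊆ {r : ℝ | ∃ y ∈ K, dist x y = r}) ∧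
      0 < volume {r : ℝ | ∃ y ∈ K, dist x y = r} := by
  subst hK
  obtain ⟨u, v, huv, h⟩ := final_num _ _ rfl rfl x
  refine ⟨⟨u, v, huv, h⟩, ?_⟩
  refine lt_of_lt_of_le ?_ (measure_mono h)
  rw [Real.volume_Ioo]
  exact ENNReal.ofReal_pos.2 (sub_pos.2 huv)
end
end
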